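/- Let p > 1 and q ∈ L^1(0,1) be 1-periodic. Suppose the spectrum of the periodic eigenvalue problem -( (y')^{(p-1)} )' = (p-1)(λ - q) y^{(p-1)}, y(0) = y(1), y'(0) = y'(1) contains { (2nπ̂)^p : n ∈ N ∪ {0} } and 0 is the least eigenvalue. Then q = 0 almost everywhere on [0,1]. -/

import Mathlib

open MeasureTheory Real Set Filter intervalIntegral
open scoped Topology

/-- The signed power `f^{(r)} = |f|^r sgn f`. -/
noncomputable def sgnPow (r x : ℝ) : ℝ := |x| ^ r * Real.sign x

/-- The generalized half-period `π̂ = 2π/(p sin(π/p))`. -/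
noncomputable def pihat (p : ℝ) : ℝ := 2 * Real.pi / (p * Real.sin (Real.pi / p))

/-- `lam` is an eigenvalue of the periodic `p`-Laplacian
`-((y')^{(p-1)})' = (p-1)(λ - q) y^{(p-1)}`, `y(0) = y(1)`, `y'(0) = y'(1)`,
with the equation understood in the integrated (Carathéodory) sense. -/
def IsPeriodicEig (p : ℝ) (q : ℝ → ℝ) (lam : ℝ) : Prop :=
  ∃ y : ℝ → ℝ, Differentiable ℝ y ∧ (∃ x, y x ≠ 0) ∧
    (∀ a b : ℝ, sgnPow (p - 1) (deriv y b) - sgnPow (p - 1) (deriv y a) =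
      -∫ t in a..b, (p - 1) * (lam - q t) * sgnPow (p - 1) (y t)) ∧
    y 0 = y 1 ∧ deriv y 0 = deriv y 1

/-- `f` is absolutely continuous on the interval with endpoints `a`, `b`, with a.e. derivative
`f'`. -/
structure HasACDerivOn (f f' : ℝ → ℝ) (a b : ℝ) : Prop where
  ac : AbsolutelyContinuousOnInterval f a b
  deriv : ∀ᵐ t, t ∈ uIcc a b → HasDerivAt f (f' t) t

namespace HasACDerivOn

variable {f g f' g' : ℝ → ℝ} {a b : ℝ}

theorem ae_deriv_eq (hf : HasACDerivOn f f' a b) :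
    ∀ᵐ t, t ∈ uIoc a b → _root_.deriv f t = f' t := by
  filter_upwards [hf.deriv] with t ht hmem using (ht (uIoc_subset_uIcc hmem)).deriv

theorem integral_eq_sub (hf : HasACDerivOn f f' a b) : ∫ t in a..b, f' t = f b - f a := by
  rw [← hf.ac.integral_deriv_eq_sub]
  refine (intervalIntegral.integral_congr_ae hf.ae_deriv_eq).symm

theorem intervalIntegrable (hf : HasACDerivOn f f' a b) : IntervalIntegrable f' volume a b :=
  hf.ac.intervalIntegrable_deriv.congr_ae
    ((ae_restrict_iff' measurableSet_uIoc).2 hf.ae_deriv_eq)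

theorem congr_deriv (hf : HasACDerivOn f f' a b) (h : ∀ t, t ∈ uIcc a b → f' t = g' t) :
    HasACDerivOn f g' a b :=
  ⟨hf.ac, by filter_upwards [hf.deriv] with t ht hm using h t hm ▸ ht hm⟩

theorem add (hf : HasACDerivOn f f' a b) (hg : HasACDerivOn g g' a b) :
    HasACDerivOn (fun t => f t + g t) (fun t => f' t + g' t) a b :=
  ⟨hf.ac.add hg.ac, by
    filter_upwards [hf.deriv, hg.deriv] with t h1 h2 hm using (h1 hm).add (h2 hm)⟩

theorem mul (hf : HasACDerivOn f f' a b) (hg : HasACDerivOn g g' a b) :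
    HasACDerivOn (fun t => f t * g t) (fun t => f' t * g t + f t * g' t) a b :=
  ⟨hf.ac.mul hg.ac, by
    filter_upwards [hf.deriv, hg.deriv] with t h1 h2 hm using (h1 hm).mul (h2 hm)⟩

theorem const_mul (c : ℝ) (hf : HasACDerivOn f f' a b) :
    HasACDerivOn (fun t => c * f t) (fun t => c * f' t) a b :=
  ⟨hf.ac.const_mul c, by
    filter_upwards [hf.deriv] with t h1 hm using (h1 hm).const_mul c⟩

theorem of_integral {c C : ℝ} (hg : ∀ a b, IntervalIntegrable g volume a b)
    (h : ∀ t, f t = C + ∫ s in c..t, g s) (a b : ℝ) : HasACDerivOn f g a b := by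
  have hf : f = fun t => (f a) + ∫ s in a..t, g s := by
    funext t
    rw [h t, h a, add_assoc, intervalIntegral.integral_add_adjacent_intervals (hg _ _) (hg _ _)]
  constructor
  · have h1 := (hg a b).absolutelyContinuousOnInterval_intervalIntegral (c := a) left_mem_uIcc
    have h2 : AbsolutelyContinuousOnInterval (fun _ : ℝ => f a) a b :=
      contDiffOn_const.absolutelyContinuousOnInterval
    rw [hf]
    exact h2.add h1
  · filter_upwards [(hg a b).ae_hasDerivAt_integral] with t ht hm
    rw [hf]
    exact (ht hm a left_mem_uIcc).const_add _

theorem of_hasDerivAt (hf : ∀ t, HasDerivAt f (f' t) t) (hc : Continuous f') (a b : ℝ) :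
    HasACDerivOn f f' a b := by
  refine ⟨ContDiffOn.absolutelyContinuousOnInterval ?_, ae_of_all _ fun t _ => hf t⟩
  apply ContDiff.contDiffOn
  rw [contDiff_one_iff_deriv]
  refine ⟨fun t => (hf t).differentiableAt, ?_⟩
  rwa [show _root_.deriv f = f' from funext fun t => (hf t).deriv]

theorem comp (hf : HasACDerivOn f f' a b) (hg : ∀ t ∈ uIcc a b, ContDiffAt ℝ 1 g (f t))
    (hg' : ∀ t ∈ uIcc a b, HasDerivAt g (g' (f t)) (f t)) :
    HasACDerivOn (fun t => g (f t)) (fun t => g' (f t) * f' t) a b := by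
  constructor
  · have hlip : LocallyLipschitzOn (f '' uIcc a b) g := by
      rintro _ ⟨t, ht, rfl⟩
      obtain ⟨K, s, hs, hK⟩ := (hg t ht).exists_lipschitzOnWith
      exact ⟨K, s, mem_nhdsWithin_of_mem_nhds hs, hK⟩
    obtain ⟨K, hK⟩ := hlip.exists_lipschitzOnWith_of_compact
      (isCompact_uIcc.image_of_continuousOn hf.ac.continuousOn)
    have hf0 := hf.ac
    rw [absolutelyContinuousOnInterval_iff] at hf0 ⊢
    intro ε hε
    obtain ⟨δ, hδ, H⟩ := hf0 (ε / (K + 1)) (by positivity)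
    refine ⟨δ, hδ, fun E hE hlt => ?_⟩
    calc ∑ i ∈ Finset.range E.1, dist (g (f (E.2 i).1)) (g (f (E.2 i).2))
        ≤ ∑ i ∈ Finset.range E.1, K * dist (f (E.2 i).1) (f (E.2 i).2) :=
          Finset.sum_le_sum fun i hi => hK.dist_le_mul _ ⟨_, (hE.1 i hi).1, rfl⟩ _
            ⟨_, (hE.1 i hi).2, rfl⟩
      _ = K * ∑ i ∈ Finset.range E.1, dist (f (E.2 i).1) (f (E.2 i).2) := by
          rw [Finset.mul_sum]
      _ ≤ K * (ε / (K + 1)) := by gcongr; exact (H E hE hlt).le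
      _ < (K + 1) * (ε / (K + 1)) := by gcongr; linarith
      _ = ε := by field
  · filter_upwards [hf.deriv] with t ht hm using (hg' t hm).comp t (ht hm)

theorem le_of_deriv_nonpos (hf : HasACDerivOn f f' a b) (hab : a ≤ b)
    (h : ∀ t ∈ Icc a b, f' t ≤ 0) : f b ≤ f a := by
  have := hf.integral_eq_sub
  have h2 : 0 ≤ ∫ t in a..b, -f' t :=
    intervalIntegral.integral_nonneg hab fun t ht => neg_nonneg.2 (h t ht)
  rw [intervalIntegral.integral_neg] at h2
  linarith

end HasACDerivOn

theorem sgnPow_zero (r : ℝ) : sgnPow r 0 = 0 := by simp [sgnPow]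

theorem sgnPow_of_pos (r : ℝ) {x : ℝ} (hx : 0 < x) : sgnPow r x = x ^ r := by
  simp [sgnPow, Real.sign_of_pos hx, abs_of_pos hx]

theorem sgnPow_neg (r x : ℝ) : sgnPow r (-x) = -sgnPow r x := by
  simp [sgnPow, Real.sign_neg]

theorem sgnPow_mul (r x y : ℝ) : sgnPow r (x * y) = sgnPow r x * sgnPow r y := by
  have hs : Real.sign (x * y) = Real.sign x * Real.sign y := by
    rcases lt_trichotomy x 0 with hx | rfl | hx <;> rcases lt_trichotomy y 0 with hy | rfl | hy <;>
      simp [Real.sign_of_pos, Real.sign_of_neg, mul_pos_of_neg_of_neg, mul_neg_of_neg_of_pos,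
        mul_neg_of_pos_of_neg, *]
  rw [sgnPow, sgnPow, sgnPow, hs, abs_mul, mul_rpow (abs_nonneg _) (abs_nonneg _)]
  ring

theorem sgnPow_inv (r x : ℝ) : sgnPow r x⁻¹ = (sgnPow r x)⁻¹ := by
  rcases eq_or_ne x 0 with rfl | hx
  · simp [sgnPow_zero]
  · refine eq_inv_of_mul_eq_one_left ?_
    rw [← sgnPow_mul, inv_mul_cancel₀ hx, sgnPow_of_pos r one_pos, one_rpow]

theorem sgnPow_div (r x y : ℝ) : sgnPow r (x / y) = sgnPow r x / sgnPow r y := by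
  rw [div_eq_mul_inv, sgnPow_mul, sgnPow_inv, div_eq_mul_inv]

theorem sgnPow_ne_zero (r : ℝ) {x : ℝ} (hx : x ≠ 0) : sgnPow r x ≠ 0 := by
  rcases lt_or_gt_of_ne hx with h | h
  · have := sgnPow_of_pos r (neg_pos.2 h)
    rw [sgnPow_neg] at this
    have h2 : 0 < (-x) ^ r := rpow_pos_of_pos (neg_pos.2 h) r
    intro h0
    rw [h0] at this
    linarith
  · rw [sgnPow_of_pos r h]
    exact (rpow_pos_of_pos h r).ne'

theorem abs_sgnPow {r : ℝ} (hr : 0 < r) (x : ℝ) : |sgnPow r x| = |x| ^ r := by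
  rcases lt_trichotomy x 0 with hx | rfl | hx
  · rw [sgnPow, Real.sign_of_neg hx, abs_mul, abs_neg, abs_one, mul_one,
      abs_of_nonneg (rpow_nonneg (abs_nonneg _) _)]
  · simp [sgnPow, zero_rpow hr.ne']
  · rw [sgnPow, Real.sign_of_pos hx, abs_mul, abs_one, mul_one,
      abs_of_nonneg (rpow_nonneg (abs_nonneg _) _)]

theorem self_mul_sgnPow {r : ℝ} (hr : 0 < r) (x : ℝ) : x * sgnPow r x = |x| ^ (1 + r) := by
  rcases eq_or_ne x 0 with rfl | hx
  · rw [zero_mul, abs_zero, zero_rpow (by linarith)]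
  · rw [rpow_add (abs_pos.2 hx), rpow_one, sgnPow]
    have : x * Real.sign x = |x| := by
      rcases lt_or_gt_of_ne hx with h | h
      · rw [Real.sign_of_neg h, abs_of_neg h]; ring
      · rw [Real.sign_of_pos h, abs_of_pos h]; ring
    rw [← this]; ring

theorem sgnPow_inv_sgnPow {r : ℝ} (hr : 0 < r) (x : ℝ) : sgnPow r⁻¹ (sgnPow r x) = x := by
  have key : ∀ y : ℝ, 0 < y → sgnPow r⁻¹ (sgnPow r y) = y := fun y hy => by
    rw [sgnPow_of_pos r hy, sgnPow_of_pos _ (rpow_pos_of_pos hy r), rpow_rpow_inv hy.le hr.ne']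
  rcases lt_trichotomy x 0 with hx | rfl | hx
  · have := key (-x) (neg_pos.2 hx)
    rw [sgnPow_neg, sgnPow_neg] at this
    linarith
  · simp [sgnPow_zero]
  · exact key x hx

theorem sgnPow_sgnPow_inv {r : ℝ} (hr : 0 < r) (x : ℝ) : sgnPow r (sgnPow r⁻¹ x) = x := by
  simpa using sgnPow_inv_sgnPow (inv_pos.2 hr) x

theorem hasDerivAt_abs_rpow_one_add {r : ℝ} (hr : 0 < r) (x : ℝ) :
    HasDerivAt (fun x : ℝ => |x| ^ (1 + r)) ((1 + r) * sgnPow r x) x := by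
  convert! hasDerivAt_abs_rpow x (by linarith : 1 < 1 + r) using 1
  rcases eq_or_ne x 0 with rfl | hx
  · simp [sgnPow_zero]
  · rw [mul_assoc]
    congr 1
    rw [show 1 + r - 2 = r - 1 by ring, rpow_sub_one (abs_pos.2 hx).ne', sgnPow]
    rcases lt_or_gt_of_ne hx with h | h
    · rw [Real.sign_of_neg h, abs_of_neg h]; field_simp
    · rw [Real.sign_of_pos h, abs_of_pos h]; field_simp

theorem contDiff_abs_rpow_one_add {r : ℝ} (hr : 0 < r) :
    ContDiff ℝ 1 (fun x : ℝ => |x| ^ (1 + r)) := by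
  simpa [Real.norm_eq_abs] using contDiff_norm_rpow (E := ℝ) (by linarith : 1 < 1 + r)

theorem continuous_sgnPow {r : ℝ} (hr : 0 < r) : Continuous (sgnPow r) := by
  have h := (contDiff_one_iff_deriv.1 (contDiff_abs_rpow_one_add hr)).2
  rw [show deriv (fun x : ℝ => |x| ^ (1 + r)) = fun x => (1 + r) * sgnPow r x from
    funext fun x => (hasDerivAt_abs_rpow_one_add hr x).deriv] at h
  convert h.const_mul (1 + r)⁻¹ using 2 with x
  rw [inv_mul_cancel_left₀ (by linarith)]

theorem contDiffAt_sgnPow (r : ℝ) {x : ℝ} (hx : x ≠ 0) : ContDiffAt ℝ 1 (sgnPow r) x := by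
  rcases lt_or_gt_of_ne hx with h | h
  · have : ContDiffAt ℝ 1 (fun y : ℝ => -(-y) ^ r) x :=
      (contDiffAt_fun_id.neg.rpow_const_of_ne (neg_pos.2 h).ne').neg
    refine this.congr_of_eventuallyEq ?_
    filter_upwards [eventually_lt_nhds h] with y hy
    rw [← sgnPow_of_pos r (neg_pos.2 hy), sgnPow_neg, neg_neg]
  · have : ContDiffAt ℝ 1 (fun y : ℝ => y ^ r) x :=
      contDiffAt_fun_id.rpow_const_of_ne hx
    refine this.congr_of_eventuallyEq ?_
    filter_upwards [eventually_gt_nhds h] with y hy using sgnPow_of_pos r hy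

theorem hasDerivAt_sgnPow (r : ℝ) {x : ℝ} (hx : x ≠ 0) :
    HasDerivAt (sgnPow r) (r * |x| ^ (r - 1)) x := by
  rcases lt_or_gt_of_ne hx with h | h
  · have := ((hasDerivAt_neg x).rpow_const (p := r) (Or.inl (neg_pos.2 h).ne')).neg
    rw [abs_of_neg h]
    convert! this.congr_of_eventuallyEq (f₁ := sgnPow r) ?_ using 1
    · ring
    filter_upwards [eventually_lt_nhds h] with y hy
    have := sgnPow_of_pos r (neg_pos.2 hy)
    rw [sgnPow_neg] at this
    simp [← this]
  · have := (hasDerivAt_id x).rpow_const (p := r) (Or.inl h.ne')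
    rw [abs_of_pos h]
    convert! this.congr_of_eventuallyEq (f₁ := sgnPow r) ?_ using 1
    · simp
    filter_upwards [eventually_gt_nhds h] with y hy using sgnPow_of_pos r hy

theorem abs_sgnPow_inv_rpow {r : ℝ} (hr : 0 < r) (z : ℝ) :
    |sgnPow r⁻¹ z| ^ (1 + r) = |z| ^ (1 + r⁻¹) := by
  rw [abs_sgnPow (inv_pos.2 hr), ← rpow_mul (abs_nonneg _)]
  congr 1
  field_simp
  ring

/-- The generalised arctangent `∫₀ˣ ds / (1 + |s|^a)`. -/
noncomputable def genArctan (a x : ℝ) : ℝ := ∫ s in (0 : ℝ)..x, (1 + |s| ^ a)⁻¹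

theorem continuous_genArctan_integrand {a : ℝ} (ha : 0 < a) :
    Continuous fun s : ℝ => (1 + |s| ^ a)⁻¹ := by
  refine Continuous.inv₀ (continuous_const.add (continuous_abs.rpow_const fun _ => Or.inr ha.le)) ?_
  intro x
  have := rpow_nonneg (abs_nonneg x) a
  positivity

theorem hasDerivAt_genArctan {a : ℝ} (ha : 0 < a) (x : ℝ) :
    HasDerivAt (genArctan a) (1 + |x| ^ a)⁻¹ x :=
  (continuous_genArctan_integrand ha).integral_hasStrictDerivAt 0 x |>.hasDerivAt

theorem contDiff_genArctan {a : ℝ} (ha : 0 < a) : ContDiff ℝ 1 (genArctan a) := by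
  rw [contDiff_one_iff_deriv]
  refine ⟨fun t => (hasDerivAt_genArctan ha t).differentiableAt, ?_⟩
  rw [show deriv (genArctan a) = _ from funext fun t => (hasDerivAt_genArctan ha t).deriv]
  exact continuous_genArctan_integrand ha

theorem genArctan_zero (a : ℝ) : genArctan a 0 = 0 := by simp [genArctan]

theorem genArctan_neg (a x : ℝ) : genArctan a (-x) = -genArctan a x := by
  have := intervalIntegral.integral_comp_neg (a := 0) (b := x) fun s : ℝ => (1 + |s| ^ a)⁻¹
  simp only [abs_neg, neg_zero] at this
  rw [genArctan, genArctan, this, intervalIntegral.integral_symm]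

theorem intervalIntegrable_beta_integrand {p : ℝ} (hp : 1 < p) :
    IntervalIntegrable (fun u : ℝ => u ^ (1 / p - 1) * (1 - u) ^ (-(1 / p))) volume 0 1 := by
  have h0 : 0 < p := by linarith
  have h1 : 1 / p < 1 := (div_lt_one h0).2 hp
  have h := Complex.betaIntegral_convergent (u := ((1 / p : ℝ) : ℂ)) (v := ((1 - 1 / p : ℝ) : ℂ))
    (by rw [Complex.ofReal_re]; positivity) (by rw [Complex.ofReal_re]; linarith)
  rw [intervalIntegrable_iff_integrableOn_Ioc_of_le zero_le_one] at h ⊢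
  refine (Integrable.re h).congr ?_
  refine (ae_restrict_iff' measurableSet_Ioc).2 (ae_of_all _ fun x hx => ?_)
  have e1 : ((1 / p : ℝ) : ℂ) - 1 = ((1 / p - 1 : ℝ) : ℂ) := by push_cast; ring
  have e2 : ((1 - 1 / p : ℝ) : ℂ) - 1 = ((-(1 / p) : ℝ) : ℂ) := by push_cast; ring
  have e3 : (1 : ℂ) - x = ((1 - x : ℝ) : ℂ) := by push_cast; ring
  simp only [e1, e2, e3]
  rw [← Complex.ofReal_cpow hx.1.le, ← Complex.ofReal_cpow (by linarith [hx.2]),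
    ← Complex.ofReal_mul]
  simp

theorem integral_beta_integrand {p : ℝ} (hp : 1 < p) :
    ∫ u in (0 : ℝ)..1, u ^ (1 / p - 1) * (1 - u) ^ (-(1 / p)) = π / Real.sin (π / p) := by
  have h0 : 0 < p := by linarith
  have h1 : 1 / p < 1 := (div_lt_one h0).2 hp
  have h := Complex.Gamma_mul_Gamma_eq_betaIntegral
    (s := ((1 / p : ℝ) : ℂ)) (t := ((1 - 1 / p : ℝ) : ℂ))
    (by rw [Complex.ofReal_re]; positivity) (by rw [Complex.ofReal_re]; linarith)
  have e0 : ((1 / p : ℝ) : ℂ) + ((1 - 1 / p : ℝ) : ℂ) = 1 := by push_cast; ring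
  rw [e0, Complex.Gamma_one, one_mul, Complex.Gamma_ofReal, Complex.Gamma_ofReal,
    ← Complex.ofReal_mul, Real.Gamma_mul_Gamma_one_sub] at h
  have hb : Complex.betaIntegral ((1 / p : ℝ) : ℂ) ((1 - 1 / p : ℝ) : ℂ) =
      ((∫ u in (0 : ℝ)..1, u ^ (1 / p - 1) * (1 - u) ^ (-(1 / p)) : ℝ) : ℂ) := by
    rw [Complex.betaIntegral, ← intervalIntegral.integral_ofReal]
    refine intervalIntegral.integral_congr fun x hx => ?_
    rw [uIcc_of_le zero_le_one] at hx
    have e1 : ((1 / p : ℝ) : ℂ) - 1 = ((1 / p - 1 : ℝ) : ℂ) := by push_cast; ring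
    have e2 : ((1 - 1 / p : ℝ) : ℂ) - 1 = ((-(1 / p) : ℝ) : ℂ) := by push_cast; ring
    have e3 : (1 : ℂ) - x = ((1 - x : ℝ) : ℂ) := by push_cast; ring
    simp only [e1, e2, e3]
    rw [← Complex.ofReal_cpow hx.1, ← Complex.ofReal_cpow (by linarith [hx.2]),
      ← Complex.ofReal_mul]
  rw [hb] at h
  have := Complex.ofReal_injective h
  rw [← this]
  congr 2
  ring

theorem genArctan_eq_integral {p : ℝ} (hp : 1 < p) {x : ℝ} (hx : 0 < x) :
    genArctan p x = p⁻¹ * ∫ u in (0 : ℝ)..(x ^ p / (1 + x ^ p)),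
      u ^ (1 / p - 1) * (1 - u) ^ (-(1 / p)) := by
  have h0 : 0 < p := by linarith
  set f : ℝ → ℝ := fun u => u ^ (1 / p - 1) * (1 - u) ^ (-(1 / p))
  set F : ℝ → ℝ := fun u => ∫ t in (0 : ℝ)..u, f t
  set φ : ℝ → ℝ := fun x => x ^ p / (1 + x ^ p)
  have hφc : ContinuousOn φ (Icc 0 x) := by
    refine ContinuousOn.div ?_ ?_ ?_
    · exact (continuous_id.rpow_const fun _ => Or.inr h0.le).continuousOn
    · exact (continuous_const.add (continuous_id.rpow_const fun _ => Or.inr h0.le)).continuousOn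
    · intro t ht
      have := rpow_nonneg ht.1 p
      positivity
  have hφm : ∀ t, 0 ≤ t → φ t ∈ Icc (0 : ℝ) 1 := fun t ht => by
    have := rpow_nonneg ht p
    exact ⟨by positivity, (div_le_one (by positivity)).2 (by linarith)⟩
  have hFc : ContinuousOn F (Icc 0 1) := by
    have := intervalIntegral.continuousOn_primitive_interval'
      (intervalIntegrable_beta_integrand hp) left_mem_uIcc
    rwa [uIcc_of_le zero_le_one] at this
  set D : ℝ → ℝ := fun x => genArctan p x - p⁻¹ * F (φ x)
  have hD : ContinuousOn D (Icc 0 x) := by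
    refine ContinuousOn.sub (contDiff_genArctan h0).continuous.continuousOn ?_
    exact continuousOn_const.mul (hFc.comp hφc fun t ht => hφm t ht.1)
  have hD' : ∀ t ∈ Ioo 0 x, HasDerivAt D 0 t := by
    intro t ht
    have ht0 : 0 < t := ht.1
    have htp : 0 < t ^ p := rpow_pos_of_pos ht0 p
    have hm : φ t ∈ Ioo (0 : ℝ) 1 :=
      ⟨by positivity, (div_lt_one (by positivity)).2 (by linarith)⟩
    have hfc : ContinuousOn f (Ioo 0 1) := by
      refine ContinuousOn.mul ?_ ?_
      · exact continuousOn_id.rpow_const fun u hu => Or.inl hu.1.ne'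
      · exact (continuousOn_const.sub continuousOn_id).rpow_const fun u hu =>
          Or.inl (sub_pos.2 hu.2).ne'
    have hF' : HasDerivAt F (f (φ t)) (φ t) := by
      refine intervalIntegral.integral_hasDerivAt_right ?_ ?_ ?_
      · refine (intervalIntegrable_beta_integrand hp).mono_set ?_
        rw [uIcc_of_le hm.1.le, uIcc_of_le zero_le_one]
        exact Icc_subset_Icc_right hm.2.le
      · exact hfc.stronglyMeasurableAtFilter isOpen_Ioo _ hm
      · exact hfc.continuousAt (isOpen_Ioo.mem_nhds hm)
    have hpow : HasDerivAt (fun x : ℝ => x ^ p) (p * t ^ (p - 1)) t :=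
      Real.hasDerivAt_rpow_const (Or.inl ht0.ne')
    have hφ' : HasDerivAt φ (p * t ^ (p - 1) / (1 + t ^ p) ^ 2) t := by
      convert! hpow.div (hpow.const_add 1) (by positivity) using 1
      ring
    have h1 := (hasDerivAt_genArctan h0 t).sub ((hF'.comp t hφ').const_mul p⁻¹)
    convert! h1 using 1
    have e1 : 1 - φ t = (1 + t ^ p)⁻¹ := by
      simp only [φ]; field_simp; ring
    have e2 : f (φ t) = t ^ (1 - p) * (1 + t ^ p) := by
      simp only [f]
      rw [e1]
      simp only [φ]
      rw [div_rpow htp.le (by positivity), inv_rpow (by positivity), rpow_neg (by positivity),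
        inv_inv, ← rpow_mul ht0.le, rpow_sub_one (by positivity : (1 + t ^ p) ≠ 0)]
      rw [show p * (1 / p - 1) = 1 - p by field_simp]
      have : (1 + t ^ p) ^ (1 / p) ≠ 0 := (rpow_pos_of_pos (by positivity) _).ne'
      field_simp
    rw [e2, abs_of_pos ht0]
    have e3 : t ^ (1 - p) * t ^ (p - 1) = 1 := by
      rw [← rpow_add ht0]; simp
    have e4 : p⁻¹ * (t ^ (1 - p) * (1 + t ^ p) * (p * t ^ (p - 1) / (1 + t ^ p) ^ 2)) =
        (t ^ (1 - p) * t ^ (p - 1)) * (1 + t ^ p)⁻¹ := by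
      field_simp
    rw [e4, e3]
    ring
  obtain ⟨c, hc, hc'⟩ := exists_hasDerivAt_eq_slope D (fun _ => 0) hx hD hD'
  have hx0 : D x - D 0 = 0 := by
    rw [eq_div_iff (by linarith), zero_mul] at hc'
    exact hc'.symm
  have hD0 : D 0 = 0 := by
    simp [D, genArctan_zero, φ, F, zero_rpow h0.ne']
  have : D x = 0 := by linarith
  exact sub_eq_zero.1 this

theorem tendsto_genArctan_atTop {p : ℝ} (hp : 1 < p) :
    Tendsto (genArctan p) atTop (𝓝 (pihat p / 2)) := by
  have h0 : 0 < p := by linarith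
  have hlim : Tendsto (fun x : ℝ => x ^ p / (1 + x ^ p)) atTop (𝓝[Icc 0 1] 1) := by
    refine tendsto_nhdsWithin_iff.2 ⟨?_, ?_⟩
    · have h1 : Tendsto (fun x : ℝ => 1 - (1 + x ^ p)⁻¹) atTop (𝓝 (1 - 0)) :=
        tendsto_const_nhds.sub (tendsto_inv_atTop_zero.comp
          (tendsto_atTop_add_const_left _ _ (tendsto_rpow_atTop h0)))
      rw [sub_zero] at h1
      refine h1.congr' ?_
      filter_upwards [eventually_gt_atTop 0] with x hx
      have := rpow_pos_of_pos hx p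
      field_simp
      ring
    · filter_upwards [eventually_gt_atTop 0] with x hx
      have := rpow_pos_of_pos hx p
      exact ⟨by positivity, (div_le_one (by positivity)).2 (by linarith)⟩
  have hFc := intervalIntegral.continuousOn_primitive_interval'
      (intervalIntegrable_beta_integrand hp) left_mem_uIcc
  rw [uIcc_of_le zero_le_one] at hFc
  have h1 := (((hFc 1 ⟨zero_le_one, le_rfl⟩).tendsto.comp hlim).const_mul p⁻¹)
  rw [integral_beta_integrand hp] at h1
  have e : p⁻¹ * (π / Real.sin (π / p)) = pihat p / 2 := by
    rw [pihat]; ring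
  rw [e] at h1
  refine h1.congr' ?_
  filter_upwards [eventually_gt_atTop 0] with x hx using (genArctan_eq_integral hp hx).symm

theorem genArctan_add_genArctan {r : ℝ} (hr : 0 < r) {x : ℝ} (hx : 0 < x) :
    genArctan (1 + r) x + r⁻¹ * genArctan (1 + r⁻¹) (x ^ (-r)) = pihat (1 + r) / 2 := by
  set D : ℝ → ℝ := fun x => genArctan (1 + r) x + r⁻¹ * genArctan (1 + r⁻¹) (x ^ (-r))
  have hr' : 0 < r⁻¹ := inv_pos.2 hr
  have hD' : ∀ t, 0 < t → HasDerivAt D 0 t := by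
    intro t ht
    have h1 := (hasDerivAt_genArctan (by linarith : 0 < 1 + r) t).add
      (((hasDerivAt_genArctan (by linarith : 0 < 1 + r⁻¹) (t ^ (-r))).comp t
        (Real.hasDerivAt_rpow_const (p := -r) (Or.inl ht.ne'))).const_mul r⁻¹)
    convert! h1 using 1
    rw [abs_of_pos ht, abs_of_pos (rpow_pos_of_pos ht _), ← rpow_mul ht.le,
      show -r * (1 + r⁻¹) = -(1 + r) by field_simp; ring, show -r - 1 = -(1 + r) by ring,
      rpow_neg ht.le]
    have := rpow_pos_of_pos ht (1 + r)
    field_simp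
    ring
  have hconst : ∀ y, x < y → D y = D x := by
    intro y hxy
    obtain ⟨c, -, hc'⟩ := exists_hasDerivAt_eq_slope D (fun _ => 0) hxy
      (fun t ht => (hD' t (lt_of_lt_of_le hx ht.1)).continuousAt.continuousWithinAt)
      (fun t ht => hD' t (hx.trans ht.1))
    rw [eq_div_iff (by linarith), zero_mul] at hc'
    linarith
  have hlim : Tendsto D atTop (𝓝 (pihat (1 + r) / 2 + r⁻¹ * 0)) := by
    refine (tendsto_genArctan_atTop (by linarith : 1 < 1 + r)).add (Tendsto.const_mul _ ?_)
    have h2 : Tendsto (genArctan (1 + r⁻¹)) (𝓝 0) (𝓝 0) := by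
      have := (contDiff_genArctan (by linarith : 0 < 1 + r⁻¹)).continuous.tendsto 0
      rwa [genArctan_zero] at this
    exact h2.comp (tendsto_rpow_neg_atTop hr)
  rw [mul_zero, add_zero] at hlim
  refine tendsto_nhds_unique ?_ hlim
  refine Tendsto.congr' ?_ tendsto_const_nhds
  filter_upwards [eventually_gt_atTop x] with y hy using (hconst y hy).symm

theorem HasACDerivOn.genArctan_div {r : ℝ} (hr : 0 < r) {Y Z Y' Z' : ℝ → ℝ} {a b : ℝ}
    (hY : HasACDerivOn Y Y' a b) (hZ : HasACDerivOn Z Z' a b) (hne : ∀ t ∈ uIcc a b, Z t ≠ 0) :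
    HasACDerivOn (fun t => genArctan (1 + r) (Y t / sgnPow r⁻¹ (Z t)))
      (fun t => (Y' t * Z t - r⁻¹ * (Y t * Z' t)) / (|Y t| ^ (1 + r) + |Z t| ^ (1 + r⁻¹))) a b := by
  have h1r : 0 < 1 + r := by linarith
  have hsne : ∀ t ∈ uIcc a b, sgnPow r⁻¹ (Z t) ≠ 0 := fun t ht => sgnPow_ne_zero _ (hne t ht)
  have hζ := hZ.comp (g := sgnPow r⁻¹) (g' := fun x => r⁻¹ * |x| ^ (r⁻¹ - 1))
    (fun t ht => contDiffAt_sgnPow _ (hne t ht)) (fun t ht => hasDerivAt_sgnPow _ (hne t ht))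
  have hi := hζ.comp (g := fun x => x⁻¹) (g' := fun x => -(x ^ 2)⁻¹)
    (fun t ht => contDiffAt_inv ℝ (hsne t ht)) (fun t ht => hasDerivAt_inv (hsne t ht))
  have hA := (hY.mul hi).comp (g := genArctan (1 + r)) (g' := fun x => (1 + |x| ^ (1 + r))⁻¹)
    (fun t _ => (contDiff_genArctan h1r).contDiffAt) (fun t _ => hasDerivAt_genArctan h1r _)
  simp only [← div_eq_mul_inv] at hA
  refine hA.congr_deriv fun t ht => ?_
  have hz := hne t ht
  have hs := hsne t ht
  have e1 : |Y t / sgnPow r⁻¹ (Z t)| ^ (1 + r) = |Y t| ^ (1 + r) / |Z t| ^ (1 + r⁻¹) := by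
    rw [abs_div, div_rpow (abs_nonneg _) (abs_nonneg _), abs_sgnPow_inv_rpow hr]
  have hzp : 0 < |Z t| ^ (1 + r⁻¹) := rpow_pos_of_pos (abs_pos.2 hz) _
  have hyp : 0 ≤ |Y t| ^ (1 + r) := rpow_nonneg (abs_nonneg _) _
  have e2 : |Z t| ^ (1 + r⁻¹) = Z t * sgnPow r⁻¹ (Z t) := (self_mul_sgnPow (inv_pos.2 hr) _).symm
  have e3 : |Z t| ^ (r⁻¹ - 1) = sgnPow r⁻¹ (Z t) / Z t := by
    rw [eq_div_iff hz, rpow_sub_one (abs_pos.2 hz).ne', sgnPow]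
    rcases lt_or_gt_of_ne hz with h | h
    · rw [Real.sign_of_neg h, abs_of_neg h]; field_simp
    · rw [Real.sign_of_pos h, abs_of_pos h]; field_simp
  rw [e1, e3]
  have e4 : (1 + |Y t| ^ (1 + r) / |Z t| ^ (1 + r⁻¹))⁻¹ =
      (Z t * sgnPow r⁻¹ (Z t)) / (|Y t| ^ (1 + r) + |Z t| ^ (1 + r⁻¹)) := by
    rw [← e2]; field_simp; ring
  rw [e4]
  have : 0 < |Y t| ^ (1 + r) + |Z t| ^ (1 + r⁻¹) := by positivity
  generalize |Y t| ^ (1 + r) + |Z t| ^ (1 + r⁻¹) = E at this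
  generalize sgnPow r⁻¹ (Z t) = s at hs
  field_simp
  ring

/-- The first-order system satisfied by an eigenfunction `y` and its rescaled flux `z`:
`y' = k z^{(1/r)}`, `z' = -r (k - c q) y^{(r)}`. -/
structure IsPhaseFlow (r k c : ℝ) (q y z : ℝ → ℝ) : Prop where
  deriv_fst : ∀ t, HasDerivAt y (k * sgnPow r⁻¹ (z t)) t
  continuous_snd : Continuous z
  deriv_snd : ∀ a b, HasACDerivOn z (fun t => -r * (k - c * q t) * sgnPow r (y t)) a b

/-- The energy `|y|^p + |z|^{p'}` with `p = 1 + r`. -/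
noncomputable def phaseEnergy (r : ℝ) (y z : ℝ → ℝ) (t : ℝ) : ℝ :=
  |y t| ^ (1 + r) + |z t| ^ (1 + r⁻¹)

theorem rpow_mul_le_add {r A B : ℝ} (hr : 0 < r) (hA : 0 ≤ A) (hB : 0 ≤ B) :
    A ^ r * B ≤ A ^ (1 + r) + B ^ (1 + r) := by
  have h1 : ∀ x : ℝ, 0 ≤ x → x ^ (1 + r) = x ^ r * x := fun x hx => by
    rw [add_comm, rpow_add_one' hx (by linarith)]
  rw [h1 A hA, h1 B hB]
  have h2 := rpow_nonneg hA r
  have h3 := rpow_nonneg hB r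
  rcases le_total A B with h | h
  · have := rpow_le_rpow hA h hr.le
    nlinarith [mul_le_mul_of_nonneg_right this hB, mul_nonneg h2 hA]
  · nlinarith [mul_le_mul_of_nonneg_left h h2, mul_nonneg h3 hB]

theorem abs_sgnPow_mul_le_phaseEnergy {r : ℝ} (hr : 0 < r) (y z : ℝ → ℝ) (t : ℝ) :
    |sgnPow r (y t) * sgnPow r⁻¹ (z t)| ≤ phaseEnergy r y z t := by
  rw [abs_mul, abs_sgnPow hr, phaseEnergy, ← abs_sgnPow_inv_rpow hr]
  exact rpow_mul_le_add hr (abs_nonneg _) (abs_nonneg _)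

theorem abs_mul_le_phaseEnergy {r : ℝ} (hr : 0 < r) (y z : ℝ → ℝ) (t : ℝ) :
    |y t * z t| ≤ phaseEnergy r y z t := by
  have h := rpow_mul_le_add hr (abs_nonneg (sgnPow r⁻¹ (z t))) (abs_nonneg (y t))
  rw [abs_sgnPow_inv_rpow hr, ← abs_sgnPow hr, sgnPow_sgnPow_inv hr] at h
  rw [abs_mul, phaseEnergy]
  linarith

namespace IsPhaseFlow

variable {r k c : ℝ} {q y z : ℝ → ℝ}

theorem continuous_fst (h : IsPhaseFlow r k c q y z) : Continuous y :=
  continuous_iff_continuousAt.2 fun t => (h.deriv_fst t).continuousAt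

theorem fst_ac (h : IsPhaseFlow r k c q y z) (hr : 0 < r) (a b : ℝ) :
    HasACDerivOn y (fun t => k * sgnPow r⁻¹ (z t)) a b :=
  HasACDerivOn.of_hasDerivAt h.deriv_fst
    (continuous_const.mul ((continuous_sgnPow (inv_pos.2 hr)).comp h.continuous_snd)) a b

theorem energy_ac (h : IsPhaseFlow r k c q y z) (hr : 0 < r) (a b : ℝ) :
    HasACDerivOn (phaseEnergy r y z)
      (fun t => (1 + r) * c * q t * (sgnPow r (y t) * sgnPow r⁻¹ (z t))) a b := by
  have hr' := inv_pos.2 hr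
  have h1 := (h.fst_ac hr a b).comp (g := fun x => |x| ^ (1 + r))
    (g' := fun x => (1 + r) * sgnPow r x) (fun t _ => (contDiff_abs_rpow_one_add hr).contDiffAt)
    (fun t _ => hasDerivAt_abs_rpow_one_add hr _)
  have h2 := (h.deriv_snd a b).comp (g := fun x => |x| ^ (1 + r⁻¹))
    (g' := fun x => (1 + r⁻¹) * sgnPow r⁻¹ x)
    (fun t _ => (contDiff_abs_rpow_one_add hr').contDiffAt)
    (fun t _ => hasDerivAt_abs_rpow_one_add hr' _)
  refine (h1.add h2).congr_deriv fun t _ => ?_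
  field_simp
  ring

theorem energy_nonneg (r : ℝ) (y z : ℝ → ℝ) (t : ℝ) : 0 ≤ phaseEnergy r y z t :=
  add_nonneg (rpow_nonneg (abs_nonneg _) _) (rpow_nonneg (abs_nonneg _) _)

theorem continuous_energy (h : IsPhaseFlow r k c q y z) (hr : 0 < r) :
    Continuous (phaseEnergy r y z) :=
  ((contDiff_abs_rpow_one_add hr).continuous.comp h.continuous_fst).add
    ((contDiff_abs_rpow_one_add (inv_pos.2 hr)).continuous.comp h.continuous_snd)

theorem energy_pos (h : IsPhaseFlow r k c q y z) (hr : 0 < r)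
    (hq : ∀ a b, IntervalIntegrable q volume a b) (hy : ∃ t, y t ≠ 0) (t : ℝ) :
    0 < phaseEnergy r y z t := by
  refine lt_of_le_of_ne (energy_nonneg r y z t) fun h0 => ?_
  obtain ⟨s, hs⟩ := hy
  have hs0 : 0 < phaseEnergy r y z s :=
    add_pos_of_pos_of_nonneg (rpow_pos_of_pos (abs_pos.2 hs) _) (rpow_nonneg (abs_nonneg _) _)
  set g : ℝ → ℝ := fun t => (1 + r) * |c| * |q t|
  have hg : ∀ a b, IntervalIntegrable g volume a b := fun a b => (hq a b).abs.const_mul _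
  have hb : ∀ t, |(1 + r) * c * q t * (sgnPow r (y t) * sgnPow r⁻¹ (z t))| ≤
      g t * phaseEnergy r y z t := fun t => by
    rw [abs_mul, abs_mul, abs_mul, abs_of_pos (by linarith : 0 < 1 + r)]
    exact mul_le_mul_of_nonneg_left (abs_sgnPow_mul_le_phaseEnergy hr y z t) (by positivity)
  have hG : ∀ a b, HasACDerivOn (fun u => 0 + ∫ v in t..u, g v) g a b :=
    HasACDerivOn.of_integral hg fun _ => rfl
  have hexp : ∀ σ a b, HasACDerivOn (fun u => Real.exp (σ * (0 + ∫ v in t..u, g v)))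
      (fun u => Real.exp (σ * (0 + ∫ v in t..u, g v)) * (σ * g u)) a b := fun σ a b =>
    ((hG a b).const_mul σ).comp (g := Real.exp) (g' := Real.exp)
      (fun _ _ => Real.contDiff_exp.contDiffAt) (fun _ _ => Real.hasDerivAt_exp _)
  rcases le_total t s with hts | hts
  · have := ((h.energy_ac hr t s).mul (hexp (-1) t s)).le_of_deriv_nonpos hts fun u _ => ?_
    · rw [← h0, zero_mul] at this
      exact absurd this (not_le.2 (mul_pos hs0 (Real.exp_pos _)))
    · have := (le_abs_self _).trans (hb u)
      nlinarith [Real.exp_pos (-1 * (0 + ∫ v in t..u, g v))]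
  · have := (((h.energy_ac hr s t).mul (hexp 1 s t)).const_mul (-1)).le_of_deriv_nonpos hts
      fun u _ => ?_
    · rw [← h0, zero_mul] at this
      have := mul_pos hs0 (Real.exp_pos (1 * (0 + ∫ v in t..s, g v)))
      linarith
    · have := (neg_abs_le _).trans' (neg_le_neg (hb u))
      nlinarith [Real.exp_pos (1 * (0 + ∫ v in t..u, g v))]

/-- The share `|y|^p / (|y|^p + |z|^{p'})` of the energy carried by `y`. -/
noncomputable def share (r : ℝ) (y z : ℝ → ℝ) (t : ℝ) : ℝ := |y t| ^ (1 + r) / phaseEnergy r y z t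

theorem share_nonneg (r : ℝ) (y z : ℝ → ℝ) (t : ℝ) : 0 ≤ share r y z t :=
  div_nonneg (rpow_nonneg (abs_nonneg _) _) (energy_nonneg r y z t)

theorem share_le_one (r : ℝ) (y z : ℝ → ℝ) (t : ℝ) : share r y z t ≤ 1 :=
  div_le_one_of_le₀ (le_add_of_nonneg_right (rpow_nonneg (abs_nonneg _) _)) (energy_nonneg r y z t)

theorem continuous_share (h : IsPhaseFlow r k c q y z) (hr : 0 < r)
    (hE : ∀ t, 0 < phaseEnergy r y z t) : Continuous (share r y z) :=
  ((contDiff_abs_rpow_one_add hr).continuous.comp h.continuous_fst).div (h.continuous_energy hr)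
    fun t => (hE t).ne'

theorem abs_integral_share_le (h : IsPhaseFlow r k c q y z) (hr : 0 < r) (hk : 0 < k) (hc : 0 ≤ c)
    (hq : ∀ a b, IntervalIntegrable q volume a b) (hE : ∀ t, 0 < phaseEnergy r y z t)
    {a b : ℝ} (hab : a ≤ b) :
    |∫ t in a..b, (1 - (1 + r) * share r y z t)| ≤
      (2 + (2 * r + 1) * c * ∫ t in a..b, |q t|) / k := by
  have hX := ((h.fst_ac hr a b).mul (h.deriv_snd a b)).mul ((h.energy_ac hr a b).comp
    (g := fun x => x⁻¹) (g' := fun x => -(x ^ 2)⁻¹)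
    (fun t _ => contDiffAt_inv ℝ (hE t).ne') (fun t _ => hasDerivAt_inv (hE t).ne'))
  set X : ℝ → ℝ := fun t => y t * z t * (phaseEnergy r y z t)⁻¹
  have hXb : ∀ t, |X t| ≤ 1 := fun t => by
    rw [abs_mul, abs_inv, abs_of_pos (hE t), ← div_eq_mul_inv]
    exact div_le_one_of_le₀ (abs_mul_le_phaseEnergy hr y z t) (hE t).le
  set S : ℝ → ℝ := fun t => sgnPow r (y t) * sgnPow r⁻¹ (z t) * (phaseEnergy r y z t)⁻¹
  have hSb : ∀ t, |S t| ≤ 1 := fun t => by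
    rw [abs_mul, abs_inv, abs_of_pos (hE t), ← div_eq_mul_inv]
    exact div_le_one_of_le₀ (abs_sgnPow_mul_le_phaseEnergy hr y z t) (hE t).le
  set R : ℝ → ℝ := fun t => c * (r * share r y z t - (1 + r) * (X t * S t)) * q t
  have hX2 := hX.congr_deriv
    (g' := fun t => k * (1 - (1 + r) * share r y z t) + R t) fun t _ => by
      have e1 : y t * sgnPow r (y t) = |y t| ^ (1 + r) := self_mul_sgnPow hr _
      have e2 : z t * sgnPow r⁻¹ (z t) = phaseEnergy r y z t - |y t| ^ (1 + r) := by
        rw [self_mul_sgnPow (inv_pos.2 hr), phaseEnergy]; ring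
      have e3 : k * sgnPow r⁻¹ (z t) * z t + y t * (-r * (k - c * q t) * sgnPow r (y t)) =
          k * (phaseEnergy r y z t - |y t| ^ (1 + r)) - r * (k - c * q t) * |y t| ^ (1 + r) := by
        rw [← e2, ← e1]; ring
      rw [e3]
      simp only [R, X, S, share]
      have := (hE t).ne'
      field_simp
      ring
  have hint : IntervalIntegrable (fun t => 1 - (1 + r) * share r y z t) volume a b :=
    (continuous_const.sub (continuous_const.mul (h.continuous_share hr hE))).intervalIntegrable _ _
  have hRint : IntervalIntegrable R volume a b := by
    have := hX2.intervalIntegrable.sub (hint.const_mul k)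
    refine this.congr_ae (ae_of_all _ fun t => ?_)
    simp
  have hI := hX2.integral_eq_sub
  rw [intervalIntegral.integral_add (hint.const_mul k) hRint,
    intervalIntegral.integral_const_mul] at hI
  have hRb : |∫ t in a..b, R t| ≤ (2 * r + 1) * c * ∫ t in a..b, |q t| := by
    rw [← intervalIntegral.integral_const_mul]
    refine intervalIntegral.norm_integral_le_of_norm_le (f := R)
      (g := fun t => (2 * r + 1) * c * |q t|) hab (ae_of_all _ fun t _ => ?_)
      ((hq a b).abs.const_mul _)
    rw [Real.norm_eq_abs]
    simp only [R]
    rw [abs_mul, abs_mul, abs_of_nonneg hc]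
    refine mul_le_mul_of_nonneg_right ?_ (abs_nonneg _)
    rw [mul_comm]
    refine mul_le_mul_of_nonneg_right ?_ hc
    have h1 : |X t * S t| ≤ 1 := by
      rw [abs_mul]; exact mul_le_one₀ (hXb t) (abs_nonneg _) (hSb t)
    have h2 := share_nonneg r y z t
    have h3 := share_le_one r y z t
    rw [abs_le] at h1 ⊢
    constructor <;> nlinarith
  have hXX : |X b - X a| ≤ 2 := by
    have h1 := hXb b
    have h2 := hXb a
    rw [abs_le] at *
    constructor <;> linarith
  rw [le_div_iff₀ hk]
  calc _ = |k * ∫ t in a..b, (1 - (1 + r) * share r y z t)| := by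
        rw [abs_mul, abs_of_pos hk, mul_comm]
    _ = |(X b - X a) - ∫ t in a..b, R t| := by rw [eq_sub_of_add_eq hI]
    _ ≤ _ := (abs_sub _ _).trans (add_le_add hXX hRb)

end IsPhaseFlow

/-- A real representative of the generalized polar angle of the point `(y, z)`. -/
noncomputable def phaseAngle (r y z : ℝ) : ℝ :=
  if 0 < z then genArctan (1 + r) (y / sgnPow r⁻¹ z)
  else if z < 0 then genArctan (1 + r) (y / sgnPow r⁻¹ z) + pihat (1 + r)
  else if 0 < y then pihat (1 + r) / 2 else -(pihat (1 + r) / 2)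

theorem genArctan_div_add {r y z : ℝ} (hr : 0 < r) (hy : 0 < y) (hz : 0 < z) :
    genArctan (1 + r) (y / sgnPow r⁻¹ z) + r⁻¹ * genArctan (1 + r⁻¹) (z / sgnPow r y) =
      pihat (1 + r) / 2 := by
  have hζ : 0 < sgnPow r⁻¹ z := by rw [sgnPow_of_pos _ hz]; exact rpow_pos_of_pos hz _
  have hx : 0 < y / sgnPow r⁻¹ z := div_pos hy hζ
  rw [← genArctan_add_genArctan hr hx, rpow_neg hx.le, ← sgnPow_of_pos r hx, sgnPow_div,
    sgnPow_sgnPow_inv hr, inv_div]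

theorem phaseAngle_of_pos_fst {r y : ℝ} (hr : 0 < r) (hy : 0 < y) (z : ℝ) :
    phaseAngle r y z = pihat (1 + r) / 2 - r⁻¹ * genArctan (1 + r⁻¹) (z / sgnPow r y) := by
  rcases lt_trichotomy z 0 with hz | rfl | hz
  · have h := genArctan_div_add hr hy (neg_pos.2 hz)
    rw [sgnPow_neg, div_neg, genArctan_neg, neg_div, genArctan_neg] at h
    rw [phaseAngle, if_neg hz.not_gt, if_pos hz]
    linarith
  · simp [phaseAngle, hy, genArctan_zero]
  · rw [phaseAngle, if_pos hz]
    linarith [genArctan_div_add hr hy hz]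

theorem phaseAngle_of_neg_fst {r y : ℝ} (hr : 0 < r) (hy : y < 0) (z : ℝ) :
    (phaseAngle r y z : AddCircle (2 * pihat (1 + r))) =
      ((-(pihat (1 + r) / 2) - r⁻¹ * genArctan (1 + r⁻¹) (z / sgnPow r y) : ℝ) :
        AddCircle (2 * pihat (1 + r))) := by
  rcases lt_trichotomy z 0 with hz | rfl | hz
  · have h := genArctan_div_add hr (neg_pos.2 hy) (neg_pos.2 hz)
    rw [sgnPow_neg, neg_div_neg_eq, sgnPow_neg, neg_div_neg_eq] at h
    rw [phaseAngle, if_neg hz.not_gt, if_pos hz, ← AddCircle.coe_add_period _ (-(_ / 2) - _)]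
    congr 1
    linarith
  · simp [phaseAngle, hy.not_gt, genArctan_zero]
  · have h := genArctan_div_add hr (neg_pos.2 hy) hz
    rw [sgnPow_neg, div_neg, neg_div, genArctan_neg, genArctan_neg] at h
    rw [phaseAngle, if_pos hz]
    congr 1
    linarith

theorem eventually_forall_uIcc {P : ℝ → Prop} {t : ℝ} (h : ∀ᶠ s in 𝓝 t, P s) :
    ∀ᶠ s in 𝓝 t, ∀ u ∈ uIcc t s, P u :=
  ((tendsto_const_nhds (x := t)).uIcc tendsto_id).eventually (eventually_smallSets_forall.2 h)

namespace IsPhaseFlow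

variable {r k c : ℝ} {q y z : ℝ → ℝ}

theorem integral_eq_genArctan_snd (h : IsPhaseFlow r k c q y z) (hr : 0 < r) {a b : ℝ}
    (hz : ∀ t ∈ uIcc a b, z t ≠ 0) :
    ∫ t in a..b, (k - c * (q t * share r y z t)) =
      genArctan (1 + r) (y b / sgnPow r⁻¹ (z b)) - genArctan (1 + r) (y a / sgnPow r⁻¹ (z a)) := by
  refine ((HasACDerivOn.genArctan_div hr (h.fst_ac hr a b) (h.deriv_snd a b) hz).congr_deriv
    (g' := fun t => k - c * (q t * share r y z t)) fun t ht => ?_).integral_eq_sub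
  have hzp : 0 < |z t| ^ (1 + r⁻¹) := rpow_pos_of_pos (abs_pos.2 (hz t ht)) _
  have hyp : 0 ≤ |y t| ^ (1 + r) := rpow_nonneg (abs_nonneg _) _
  have e : k * sgnPow r⁻¹ (z t) * z t - r⁻¹ * (y t * (-r * (k - c * q t) * sgnPow r (y t))) =
      k * (z t * sgnPow r⁻¹ (z t)) + (k - c * q t) * (y t * sgnPow r (y t)) := by
    field_simp; ring
  rw [e, self_mul_sgnPow hr, self_mul_sgnPow (inv_pos.2 hr), share, phaseEnergy]
  generalize |y t| ^ (1 + r) = Y at *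
  generalize |z t| ^ (1 + r⁻¹) = Z at *
  field_simp
  ring

theorem integral_eq_genArctan_fst (h : IsPhaseFlow r k c q y z) (hr : 0 < r) {a b : ℝ}
    (hy : ∀ t ∈ uIcc a b, y t ≠ 0) :
    ∫ t in a..b, (k - c * (q t * share r y z t)) =
      r⁻¹ * genArctan (1 + r⁻¹) (z a / sgnPow r (y a)) -
        r⁻¹ * genArctan (1 + r⁻¹) (z b / sgnPow r (y b)) := by
  have hac := HasACDerivOn.genArctan_div (inv_pos.2 hr) (h.deriv_snd a b) (h.fst_ac hr a b) hy
  rw [inv_inv] at hac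
  have := ((hac.const_mul (-r⁻¹)).congr_deriv
    (g' := fun t => k - c * (q t * share r y z t)) fun t ht => ?_).integral_eq_sub
  · rw [this]; ring
  have hyp : 0 < |y t| ^ (1 + r) := rpow_pos_of_pos (abs_pos.2 (hy t ht)) _
  have hzp : 0 ≤ |z t| ^ (1 + r⁻¹) := rpow_nonneg (abs_nonneg _) _
  have e : -r * (k - c * q t) * sgnPow r (y t) * y t - r * (z t * (k * sgnPow r⁻¹ (z t))) =
      -r * (k * (z t * sgnPow r⁻¹ (z t)) + (k - c * q t) * (y t * sgnPow r (y t))) := by ring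
  rw [e, self_mul_sgnPow hr, self_mul_sgnPow (inv_pos.2 hr), share, phaseEnergy]
  generalize |y t| ^ (1 + r) = Y at *
  generalize |z t| ^ (1 + r⁻¹) = Z at *
  field_simp
  ring

theorem eventually_phaseAngle_sub (h : IsPhaseFlow r k c q y z) (hr : 0 < r)
    (hE : ∀ t, 0 < phaseEnergy r y z t) (a : ℝ) :
    ∀ᶠ b in 𝓝 a, (phaseAngle r (y b) (z b) : AddCircle (2 * pihat (1 + r))) =
      phaseAngle r (y a) (z a) +
        ((∫ t in a..b, (k - c * (q t * share r y z t)) : ℝ) : AddCircle (2 * pihat (1 + r))) := by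
  have hz := h.continuous_snd.continuousAt (x := a)
  have hy := h.continuous_fst.continuousAt (x := a)
  rcases lt_trichotomy (z a) 0 with hza | hza | hza
  · filter_upwards [eventually_forall_uIcc (hz.eventually_lt_const hza)] with b hb
    have hzb := hb b right_mem_uIcc
    rw [h.integral_eq_genArctan_snd hr fun t ht => (hb t ht).ne, ← AddCircle.coe_add, phaseAngle,
      phaseAngle, if_neg hza.not_gt, if_pos hza, if_neg hzb.not_gt, if_pos hzb]
    congr 1
    ring
  · rcases lt_trichotomy (y a) 0 with hya | hya | hya
    · filter_upwards [eventually_forall_uIcc (hy.eventually_lt_const hya)] with b hb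
      have hyb := hb b right_mem_uIcc
      rw [h.integral_eq_genArctan_fst hr fun t ht => (hb t ht).ne, phaseAngle_of_neg_fst hr hyb,
        phaseAngle_of_neg_fst hr hya, ← AddCircle.coe_add]
      congr 1
      ring
    · have := hE a
      rw [phaseEnergy, hya, hza, abs_zero, zero_rpow (by positivity), zero_rpow (by positivity)]
        at this
      simp at this
    · filter_upwards [eventually_forall_uIcc (hy.eventually_const_lt hya)] with b hb
      have hyb := hb b right_mem_uIcc
      rw [h.integral_eq_genArctan_fst hr fun t ht => (hb t ht).ne', phaseAngle_of_pos_fst hr hyb,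
        phaseAngle_of_pos_fst hr hya, ← AddCircle.coe_add]
      congr 1
      ring
  · filter_upwards [eventually_forall_uIcc (hz.eventually_const_lt hza)] with b hb
    have hzb := hb b right_mem_uIcc
    rw [h.integral_eq_genArctan_snd hr fun t ht => (hb t ht).ne', ← AddCircle.coe_add, phaseAngle,
      phaseAngle, if_pos hza, if_pos hzb]
    congr 1
    ring

theorem intervalIntegrable_mul_share (h : IsPhaseFlow r k c q y z) (hr : 0 < r)
    (hq : ∀ a b, IntervalIntegrable q volume a b) (hE : ∀ t, 0 < phaseEnergy r y z t) (a b : ℝ) :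
    IntervalIntegrable (fun t => q t * share r y z t) volume a b :=
  (hq a b).mul_continuousOn (h.continuous_share hr hE).continuousOn

/-- A closed orbit of the phase flow turns by an integral multiple of the full period `2π̂`. -/
theorem exists_int_integral_eq (h : IsPhaseFlow r k c q y z) (hr : 0 < r)
    (hq : ∀ a b, IntervalIntegrable q volume a b) (hE : ∀ t, 0 < phaseEnergy r y z t)
    (hy : y 0 = y 1) (hz : z 0 = z 1) :
    ∃ m : ℤ, ∫ t in (0 : ℝ)..1, (k - c * (q t * share r y z t)) = m * (2 * pihat (1 + r)) := by
  have hint : ∀ a b, IntervalIntegrable (fun t => k - c * (q t * share r y z t)) volume a b :=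
    fun a b => intervalIntegrable_const.sub
      ((h.intervalIntegrable_mul_share hr hq hE a b).const_mul c)
  set f : ℝ → AddCircle (2 * pihat (1 + r)) := fun t => phaseAngle r (y t) (z t) -
    ((∫ s in (0 : ℝ)..t, (k - c * (q s * share r y z s)) : ℝ) : AddCircle (2 * pihat (1 + r)))
  have hf : IsLocallyConstant f := by
    refine (IsLocallyConstant.iff_eventually_eq f).2 fun a => ?_
    filter_upwards [h.eventually_phaseAngle_sub hr hE a] with b hb
    simp only [f]
    rw [hb, ← intervalIntegral.integral_add_adjacent_intervals (hint 0 a) (hint a b),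
      AddCircle.coe_add]
    abel
  have h01 := hf.apply_eq_of_preconnectedSpace 0 1
  simp only [f, hy, hz, intervalIntegral.integral_same, AddCircle.coe_zero, sub_zero] at h01
  obtain ⟨m, hm⟩ := (AddCircle.coe_eq_zero_iff _).1 (sub_eq_self.1 h01.symm)
  exact ⟨m, by rw [← hm, zsmul_eq_mul]⟩

end IsPhaseFlow

theorem exists_contDiff_integral_abs_sub_le {q : ℝ → ℝ} (hq : IntervalIntegrable q volume 0 1)
    {ε : ℝ} (hε : 0 < ε) : ∃ g : ℝ → ℝ, ContDiff ℝ 1 g ∧ ∫ t in (0 : ℝ)..1, |q t - g t| ≤ ε := by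
  have hq' := (intervalIntegrable_iff_integrableOn_Ioc_of_le zero_le_one).1 hq
  obtain ⟨g, -, hg, h⟩ := MeasureTheory.MemLp.exist_eLpNorm_sub_le ENNReal.one_ne_top le_rfl
    (memLp_one_iff_integrable.2 hq') hε
  refine ⟨g, hg.of_le (by exact_mod_cast le_top), ?_⟩
  rw [intervalIntegral.integral_of_le zero_le_one]
  simp only [← Real.norm_eq_abs]
  have hm : AEStronglyMeasurable (fun t => q t - g t) (volume.restrict (Ioc 0 1)) :=
    hq'.aestronglyMeasurable.sub hg.continuous.aestronglyMeasurable
  rw [integral_norm_eq_lintegral_enorm hm]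
  rw [eLpNorm_one_eq_lintegral_enorm] at h
  exact ENNReal.toReal_le_of_le_ofReal hε.le h

/-- A Riemann–Lebesgue lemma: a bounded function with small primitive is nearly orthogonal to a
given integrable function. -/
theorem exists_pos_forall_abs_integral_mul_le {q : ℝ → ℝ} (hq : IntervalIntegrable q volume 0 1)
    {M : ℝ} (hM : 0 < M) {η : ℝ} (hη : 0 < η) :
    ∃ δ > 0, ∀ ψ : ℝ → ℝ, Continuous ψ → (∀ t, |ψ t| ≤ M) →
      (∀ b ∈ Icc (0 : ℝ) 1, |∫ t in (0 : ℝ)..b, ψ t| ≤ δ) →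
        |∫ t in (0 : ℝ)..1, q t * ψ t| ≤ η := by
  obtain ⟨g, hg, hqg⟩ := exists_contDiff_integral_abs_sub_le hq
    (show 0 < η / (2 * M) by positivity)
  have hg' : Continuous (deriv g) := hg.continuous_deriv le_rfl
  set K : ℝ := |g 1| + ∫ t in (0 : ℝ)..1, |deriv g t|
  have hK : 0 ≤ K := add_nonneg (abs_nonneg _)
    (intervalIntegral.integral_nonneg zero_le_one fun _ _ => abs_nonneg _)
  refine ⟨η / (2 * (K + 1)), by positivity, fun ψ hψ hψM hψδ => ?_⟩
  set δ := η / (2 * (K + 1))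
  have hδK : δ * K ≤ η / 2 := by
    simp only [δ]
    rw [div_mul_eq_mul_div, div_le_iff₀ (by positivity)]
    nlinarith
  set Ψ : ℝ → ℝ := fun b => ∫ t in (0 : ℝ)..b, ψ t
  have hΨ : ∀ b, HasDerivAt Ψ (ψ b) b := fun b => hψ.integral_hasStrictDerivAt 0 b |>.hasDerivAt
  have hparts := intervalIntegral.integral_mul_deriv_eq_deriv_mul (a := 0) (b := 1)
    (fun t _ => (hg.differentiable one_ne_zero t).hasDerivAt) (fun t _ => hΨ t)
    (hg'.intervalIntegrable _ _) (hψ.intervalIntegrable _ _)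
  have hΨ0 : Ψ 0 = 0 := intervalIntegral.integral_same
  rw [hΨ0, mul_zero, sub_zero] at hparts
  have h1 : |g 1 * Ψ 1| ≤ |g 1| * δ := by
    rw [abs_mul]
    exact mul_le_mul_of_nonneg_left (hψδ 1 (right_mem_Icc.2 zero_le_one)) (abs_nonneg _)
  have h2 : |∫ t in (0 : ℝ)..1, deriv g t * Ψ t| ≤ (∫ t in (0 : ℝ)..1, |deriv g t|) * δ := by
    rw [← intervalIntegral.integral_mul_const]
    refine intervalIntegral.norm_integral_le_of_norm_le (f := fun t => deriv g t * Ψ t)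
      (g := fun t => |deriv g t| * δ) zero_le_one (ae_of_all _ fun t ht => ?_)
      ((hg'.abs.mul continuous_const).intervalIntegrable _ _)
    rw [Real.norm_eq_abs, abs_mul]
    exact mul_le_mul_of_nonneg_left (hψδ t (Ioc_subset_Icc_self ht)) (abs_nonneg _)
  have h3 : |∫ t in (0 : ℝ)..1, g t * ψ t| ≤ δ * K := by
    rw [hparts]
    refine (abs_sub _ _).trans ((add_le_add h1 h2).trans_eq ?_)
    simp only [K]
    ring
  have hd : IntervalIntegrable (fun t => q t - g t) volume 0 1 :=
    hq.sub (hg.continuous.intervalIntegrable _ _)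
  have h4 : |∫ t in (0 : ℝ)..1, (q t - g t) * ψ t| ≤ η / 2 := by
    have : (∫ t in (0 : ℝ)..1, |q t - g t| * M) ≤ η / 2 := by
      rw [intervalIntegral.integral_mul_const]
      calc _ ≤ η / (2 * M) * M := mul_le_mul_of_nonneg_right hqg hM.le
        _ = η / 2 := by field_simp
    refine le_trans (intervalIntegral.norm_integral_le_of_norm_le
      (f := fun t => (q t - g t) * ψ t)
      (g := fun t => |q t - g t| * M) zero_le_one (ae_of_all _ fun t ht => ?_)
      (hd.abs.mul_const M)) this
    rw [Real.norm_eq_abs, abs_mul]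
    exact mul_le_mul_of_nonneg_left (hψM t) (abs_nonneg _)
  have e : ∫ t in (0 : ℝ)..1, q t * ψ t =
      (∫ t in (0 : ℝ)..1, (q t - g t) * ψ t) + ∫ t in (0 : ℝ)..1, g t * ψ t := by
    rw [← intervalIntegral.integral_add (hd.mul_continuousOn hψ.continuousOn)
      ((hg.continuous.intervalIntegrable _ _).mul_continuousOn hψ.continuousOn)]
    simp only [sub_mul, sub_add_cancel]
  rw [e]
  calc _ ≤ _ := abs_add_le _ _
    _ ≤ η := by linarith

/-- The sine period is positive. -/
theorem pihat_pos {p : ℝ} (hp : 1 < p) : 0 < pihat p := by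
  have : 0 < Real.sin (π / p) := sin_pos_of_pos_of_lt_pi (by positivity) (div_lt_self pi_pos hp)
  unfold pihat
  positivity

theorem intervalIntegrable_of_periodic {q : ℝ → ℝ} (hqper : ∀ x, q (x + 1) = q x)
    (hq : IntegrableOn q (Set.Icc 0 1)) (a b : ℝ) : IntervalIntegrable q volume a b :=
  Function.Periodic.intervalIntegrable₀ hqper one_ne_zero
    ((intervalIntegrable_iff_integrableOn_Icc_of_le zero_le_one).2 hq) a b

/-- An eigenfunction for the eigenvalue `k ^ p` yields a closed phase flow. -/
theorem IsPeriodicEig.exists_isPhaseFlow {r k : ℝ} {q : ℝ → ℝ} (hr : 0 < r) (hk : 0 < k)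
    (hq : ∀ a b, IntervalIntegrable q volume a b) (h : IsPeriodicEig (1 + r) q (k ^ (1 + r))) :
    ∃ y z : ℝ → ℝ, IsPhaseFlow r k (k ^ (-r)) q y z ∧ (∃ t, y t ≠ 0) ∧ y 0 = y 1 ∧ z 0 = z 1 := by
  obtain ⟨y, hy, hne, heq, h01, hd01⟩ := h
  simp only [add_sub_cancel_left] at heq
  have hz : ∀ t, sgnPow r (deriv y t / k) = k ^ (-r) * sgnPow r (deriv y t) := fun t => by
    rw [sgnPow_div, sgnPow_of_pos r hk, rpow_neg hk.le, div_eq_mul_inv, mul_comm]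
  have hint : ∀ a b, IntervalIntegrable
      (fun t => -r * (k - k ^ (-r) * q t) * sgnPow r (y t)) volume a b := fun a b =>
    ((intervalIntegrable_const.sub ((hq a b).const_mul _)).const_mul _).mul_continuousOn
      ((continuous_sgnPow hr).comp hy.continuous).continuousOn
  have hzi : ∀ t, sgnPow r (deriv y t / k) = sgnPow r (deriv y 0 / k) +
      ∫ s in (0 : ℝ)..t, -r * (k - k ^ (-r) * q s) * sgnPow r (y s) := fun t => by
    rw [hz, hz, ← sub_eq_iff_eq_add', ← mul_sub, heq, ← intervalIntegral.integral_neg,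
      ← intervalIntegral.integral_const_mul]
    congr 1 with s
    have : k ^ (-r) * k ^ (1 + r) = k := by
      rw [← rpow_add hk]; simp
    linear_combination -r * sgnPow r (y s) * this
  have hac := HasACDerivOn.of_integral hint hzi
  refine ⟨y, fun t => sgnPow r (deriv y t / k), ⟨fun t => ?_, ?_, hac⟩, hne, h01, ?_⟩
  · rw [sgnPow_inv_sgnPow hr, mul_div_cancel₀ _ hk.ne']
    exact (hy t).hasDerivAt
  · rw [funext hzi]
    exact continuous_const.add (intervalIntegral.continuous_primitive hint 0)
  · simp only [hd01]

theorem abs_integral_mul_share_le {q s : ℝ → ℝ} (hq : IntervalIntegrable q volume 0 1)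
    (h0 : ∀ t, 0 ≤ s t) (h1 : ∀ t, s t ≤ 1) :
    |∫ t in (0 : ℝ)..1, q t * s t| ≤ ∫ t in (0 : ℝ)..1, |q t| := by
  refine intervalIntegral.norm_integral_le_of_norm_le (f := fun t => q t * s t)
    (g := fun t => |q t|) zero_le_one (ae_of_all _ fun t _ => ?_) hq.abs
  rw [Real.norm_eq_abs, abs_mul, abs_of_nonneg (h0 t)]
  exact mul_le_of_le_one_right (abs_nonneg _) (h1 t)

theorem integral_eq_zero_of_spectrum {r : ℝ} (hr : 0 < r) {q : ℝ → ℝ}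
    (hq : ∀ a b, IntervalIntegrable q volume a b)
    (hspec : ∀ n : ℕ, IsPeriodicEig (1 + r) q ((2 * n * pihat (1 + r)) ^ (1 + r))) :
    ∫ t in (0 : ℝ)..1, q t = 0 := by
  have hπ : 0 < pihat (1 + r) := pihat_pos (by linarith)
  rw [← abs_nonpos_iff]
  refine le_of_forall_pos_le_add fun η hη => ?_
  rw [zero_add]
  obtain ⟨δ, hδ, hRL⟩ := exists_pos_forall_abs_integral_mul_le (hq 0 1)
    (show 0 < 2 + r by linarith) hη
  set N := ∫ t in (0 : ℝ)..1, |q t|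
  have hk : Tendsto (fun n : ℕ => 2 * (n : ℝ) * pihat (1 + r)) atTop atTop :=
    (tendsto_natCast_atTop_atTop.const_mul_atTop two_pos).atTop_mul_const hπ
  have hc := (tendsto_rpow_neg_atTop hr).comp hk
  have hlim1 : Tendsto (fun n : ℕ => (2 * (n : ℝ) * pihat (1 + r)) ^ (-r) * N) atTop (𝓝 0) := by
    simpa using hc.mul_const N
  have hlim2 : Tendsto (fun n : ℕ => (2 + (2 * r + 1) * (2 * (n : ℝ) * pihat (1 + r)) ^ (-r) * N) /
      (2 * (n : ℝ) * pihat (1 + r))) atTop (𝓝 0) :=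
    Tendsto.div_atTop ((((hc.const_mul _).mul_const _).const_add _)) hk
  obtain ⟨n, hn1, hn2, hn0⟩ := ((hlim1.eventually_lt_const (mul_pos two_pos hπ)).and
    ((hlim2.eventually_lt_const hδ).and (hk.eventually_gt_atTop 0))).exists
  obtain ⟨y, z, hf, hne, hy, hz⟩ := (hspec n).exists_isPhaseFlow hr hn0 hq
  have hE := hf.energy_pos hr hq hne
  have hcpos := rpow_pos_of_pos hn0 (-r)
  set c := (2 * (n : ℝ) * pihat (1 + r)) ^ (-r)
  have hs0 := IsPhaseFlow.share_nonneg r y z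
  have hs1 := IsPhaseFlow.share_le_one r y z
  have hsint := hf.intervalIntegrable_mul_share hr hq hE
  have hzero : ∫ t in (0 : ℝ)..1, q t * IsPhaseFlow.share r y z t = 0 := by
    obtain ⟨m, hm⟩ := hf.exists_int_integral_eq hr hq hE hy hz
    rw [intervalIntegral.integral_sub intervalIntegrable_const ((hsint 0 1).const_mul c),
      intervalIntegral.integral_const, intervalIntegral.integral_const_mul, sub_zero, one_smul]
      at hm
    have hI := abs_integral_mul_share_le (hq 0 1) hs0 hs1
    set I := ∫ t in (0 : ℝ)..1, q t * IsPhaseFlow.share r y z t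
    have e : c * I = ((n - m : ℤ) : ℝ) * (2 * pihat (1 + r)) := by
      push_cast; linarith
    have hlt : |c * I| < 2 * pihat (1 + r) := by
      rw [abs_mul, abs_of_pos hcpos]
      exact (mul_le_mul_of_nonneg_left hI hcpos.le).trans_lt hn1
    have hnm : |(n - m : ℤ)| < 1 := by
      rw [e, abs_mul, abs_of_pos (mul_pos two_pos hπ), mul_lt_iff_lt_one_left (by positivity)]
        at hlt
      exact_mod_cast hlt
    rw [Int.abs_lt_one_iff.1 hnm, Int.cast_zero, zero_mul] at e
    exact (mul_eq_zero.1 e).resolve_left hcpos.ne'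
  have hψ := hRL (fun t => 1 - (1 + r) * IsPhaseFlow.share r y z t)
    (continuous_const.sub (continuous_const.mul (hf.continuous_share hr hE)))
    (fun t => by
      have := hs0 t
      have := hs1 t
      rw [abs_le]
      constructor <;> nlinarith)
    (fun b hb => by
      refine (hf.abs_integral_share_le hr hn0 hcpos.le hq hE hb.1).trans (le_trans ?_ hn2.le)
      have : ∫ t in (0 : ℝ)..b, |q t| ≤ N :=
        intervalIntegral.integral_mono_interval le_rfl hb.1 hb.2
          (ae_of_all _ fun t => abs_nonneg _) (hq 0 1).abs
      gcongr)
  have e : ∫ t in (0 : ℝ)..1, q t * (1 - (1 + r) * IsPhaseFlow.share r y z t) =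
      ∫ t in (0 : ℝ)..1, q t := by
    have : ∀ t, q t * (1 - (1 + r) * IsPhaseFlow.share r y z t) =
      q t - (1 + r) * (q t * IsPhaseFlow.share r y z t) := fun t => by ring
    simp only [this]
    rw [intervalIntegral.integral_sub (hq 0 1) ((hsint 0 1).const_mul _),
      intervalIntegral.integral_const_mul, hzero, mul_zero, sub_zero]
  rwa [e] at hψ

/-- `x` solves `x' = -G (x + H)`, `x 0 = 0` on `[0, 1]`. -/
structure IsShiftedSolution (G H x : ℝ → ℝ) : Prop where
  continuous : Continuous x
  map_zero : x 0 = 0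
  deriv : ∀ t ∈ Icc (0 : ℝ) 1, HasDerivWithinAt x (-G (x t + H t)) (Icc 0 1) t

theorem exists_isShiftedSolution {G H : ℝ → ℝ} {L B : NNReal} (hG : LipschitzWith L G)
    (hB : ∀ x, |G x| ≤ B) (hH : Continuous H) : ∃ x, IsShiftedSolution G H x := by
  have hPL : IsPicardLindelof (fun t x => -G (x + H t))
      (⟨0, left_mem_Icc.2 zero_le_one⟩ : Icc (0 : ℝ) 1) (0 : ℝ) B 0 B L :=
    { lipschitzOnWith := fun t _ => by
        refine LipschitzWith.lipschitzOnWith (LipschitzWith.of_dist_le_mul fun x y => ?_)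
        rw [dist_neg_neg]
        simpa using hG.dist_le_mul (x + H t) (y + H t)
      continuousOn := fun x _ => (hG.continuous.comp (continuous_const.add hH)).neg.continuousOn
      norm_le := fun t _ x _ => by
        rw [norm_neg]
        exact hB _
      mul_max_le := by simp }
  obtain ⟨α, h0, hα⟩ := hPL.exists_eq_forall_mem_Icc_hasDerivWithinAt₀
  have hcl : ∀ t ∈ Icc (0 : ℝ) 1, α (projIcc 0 1 zero_le_one t) = α t := fun t ht => by
    rw [projIcc_of_mem _ ht]
  refine ⟨fun t => α (projIcc 0 1 zero_le_one t), ?_, ?_, fun t ht => ?_⟩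
  · have : ContinuousOn α (Icc 0 1) := fun t ht => (hα t ht).continuousWithinAt
    exact (continuousOn_iff_continuous_domRestrict.1 this).Icc_extend'
  · exact (hcl 0 (left_mem_Icc.2 zero_le_one)).trans h0
  · simp only [hcl t ht]
    exact (hα t ht).congr hcl (hcl t ht)

namespace IsShiftedSolution

variable {G H H₁ H₂ x x₁ x₂ : ℝ → ℝ}

theorem deriv_right (h : IsShiftedSolution G H x) :
    ∀ t ∈ Ico (0 : ℝ) 1, HasDerivWithinAt x (-G (x t + H t)) (Ici t) t := fun t ht =>
  (h.deriv t (Ico_subset_Icc_self ht)).mono_of_mem_nhdsWithin (Icc_mem_nhdsGE_of_mem ht)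

theorem eq_neg_integral (h : IsShiftedSolution G H x) (hG : Continuous G) (hH : Continuous H)
    {t : ℝ} (ht : t ∈ Icc (0 : ℝ) 1) : x t = -∫ s in (0 : ℝ)..t, G (x s + H s) := by
  have := intervalIntegral.integral_eq_sub_of_hasDeriv_right_of_le ht.1
    (f := x) (f' := fun s => -G (x s + H s)) h.continuous.continuousOn
    (fun s hs => (h.deriv_right s ⟨hs.1.le, hs.2.trans_le ht.2⟩).mono Ioi_subset_Ici_self)
    ((hG.comp (h.continuous.add hH)).neg.intervalIntegrable _ _)
  rw [intervalIntegral.integral_neg, h.map_zero, sub_zero] at this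
  exact this.symm

theorem mem_Icc (h : IsShiftedSolution G H x) (hG : Continuous G) (hH : Continuous H)
    (h0 : ∀ w, 0 ≤ G w) {B : ℝ} (hB : ∀ w, G w ≤ B) {t : ℝ} (ht : t ∈ Icc (0 : ℝ) 1) :
    x t ∈ Icc (-B) 0 := by
  have hB0 : 0 ≤ B := (h0 0).trans (hB 0)
  have hc : Continuous fun s => G (x s + H s) := hG.comp (h.continuous.add hH)
  rw [h.eq_neg_integral hG hH ht]
  constructor
  · rw [neg_le_neg_iff]
    calc _ ≤ ∫ _ in (0 : ℝ)..t, B := intervalIntegral.integral_mono_on ht.1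
          (hc.intervalIntegrable _ _) intervalIntegrable_const fun s _ => hB _
      _ = t * B := by simp
      _ ≤ B := mul_le_of_le_one_left hB0 ht.2
  · rw [neg_nonpos]
    exact intervalIntegral.integral_nonneg ht.1 fun s _ => h0 _

theorem abs_sub_le_mul_exp {L : NNReal} (hG : LipschitzWith L G) (h₁ : IsShiftedSolution G H₁ x₁)
    (h₂ : IsShiftedSolution G H₂ x₂) {d : ℝ} (hd : ∀ t ∈ Icc (0 : ℝ) 1, |H₁ t - H₂ t| ≤ d)
    {t : ℝ} (ht : t ∈ Icc (0 : ℝ) 1) : |x₁ t - x₂ t| ≤ d * Real.exp (L + 1) := by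
  have hd0 : 0 ≤ d := (abs_nonneg _).trans (hd t ht)
  have hv : ∀ t, LipschitzWith (L + 1) fun x => -G (x + H₁ t) := fun t => by
    refine LipschitzWith.of_dist_le_mul fun x y => ?_
    rw [dist_neg_neg]
    refine (hG.dist_le_mul (x + H₁ t) (y + H₁ t)).trans ?_
    rw [dist_add_right]
    exact mul_le_mul_of_nonneg_right (by simp) dist_nonneg
  have hg := dist_le_of_approx_trajectories_ODE (εf := 0) (εg := L * d) (δ := 0) hv
    h₁.continuous.continuousOn h₁.deriv_right (fun t _ => (dist_self _).le)
    h₂.continuous.continuousOn h₂.deriv_right (fun t ht => ?_)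
    (by rw [h₁.map_zero, h₂.map_zero, dist_self]) t ht
  · rw [Real.dist_eq] at hg
    refine hg.trans ?_
    have hL : ((L + 1 : NNReal) : ℝ) ≠ 0 := by positivity
    have hL0 : (0 : ℝ) ≤ L := L.2
    rw [gronwallBound_of_K_ne_0 hL]
    simp only [zero_mul, zero_add, sub_zero, NNReal.coe_add, NNReal.coe_one]
    have he : Real.exp ((L + 1) * t) ≤ Real.exp (L + 1) :=
      Real.exp_le_exp.2 (mul_le_of_le_one_right (by positivity) ht.2)
    have h1 : 1 ≤ Real.exp ((L + 1) * t) := Real.one_le_exp (mul_nonneg (by positivity) ht.1)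
    calc (L * d / (L + 1)) * (Real.exp ((L + 1) * t) - 1)
        ≤ d * (Real.exp ((L + 1) * t) - 1) := by
          refine mul_le_mul_of_nonneg_right ?_ (by linarith)
          rw [div_le_iff₀ (by positivity)]
          nlinarith
      _ ≤ d * Real.exp (L + 1) := mul_le_mul_of_nonneg_left (by linarith) hd0
  · rw [dist_neg_neg]
    refine (hG.dist_le_mul _ _).trans (mul_le_mul_of_nonneg_left ?_ L.2)
    rw [dist_add_left, Real.dist_eq, abs_sub_comm]
    exact hd t (Ico_subset_Icc_self ht)

/-- Strict comparison: lowering the drift strictly lowers the endpoint. -/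
theorem endpoint_lt {L : NNReal} (hG : LipschitzWith L G) (h₁ : IsShiftedSolution G H₁ x₁)
    (h₂ : IsShiftedSolution G H₂ x₂) {δ : ℝ} (hδ : 0 < δ) (hH : ∀ t, H₁ t - H₂ t = δ * t) :
    x₂ 1 + H₂ 1 < x₁ 1 + H₁ 1 := by
  have hL0 : (0 : ℝ) ≤ L := L.2
  set η : ℝ := δ / (2 * (L + 1))
  have hη : 0 < η := by positivity
  have hηL : L * η + η < δ := by
    have : (L + 1) * η = δ / 2 := by simp only [η]; field_simp
    linarith
  have key := image_le_of_deriv_right_lt_deriv_boundary' (a := 0) (b := 1)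
    (f := fun t => (x₂ t - x₁ t) - δ * t) (f' := fun t => (-G (x₂ t + H₂ t) - -G (x₁ t + H₁ t)) - δ)
    (B := fun t => -η * t) (B' := fun _ => -η)
    ((h₂.continuous.sub h₁.continuous).sub (continuous_const.mul continuous_id)).continuousOn
    (fun t ht => ((h₂.deriv_right t ht).sub (h₁.deriv_right t ht)).sub
      (by simpa using ((hasDerivAt_id t).const_mul δ).hasDerivWithinAt))
    (by simp [h₁.map_zero, h₂.map_zero])
    (continuous_const.mul continuous_id).continuousOn
    (fun t _ => by simpa using ((hasDerivAt_id t).const_mul (-η)).hasDerivWithinAt)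
    (fun t ht heq => ?_) (right_mem_Icc.2 zero_le_one)
  · have := hH 1
    simp only [mul_one] at key this
    linarith
  · have hl := hG.dist_le_mul (x₁ t + H₁ t) (x₂ t + H₂ t)
    have e : x₁ t + H₁ t - (x₂ t + H₂ t) = η * t := by
      have := hH t
      linarith
    rw [Real.dist_eq, Real.dist_eq, e, abs_of_nonneg (mul_nonneg hη.le ht.1)] at hl
    have h2 : L * (η * t) ≤ L * η :=
      mul_le_mul_of_nonneg_left (mul_le_of_le_one_right hη.le ht.2.le) hL0
    have := (abs_le.1 hl).2
    linarith

end IsShiftedSolution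

theorem exists_continuous_zero_of_strictAnti {D : ℝ → ℝ → ℝ} (hD : Continuous D.uncurry)
    (hanti : ∀ a, StrictAnti fun l => D l a) {l₀ l₁ : ℝ} (hl : l₀ ≤ l₁) (h₀ : ∀ a, 0 ≤ D l₀ a)
    (h₁ : ∀ a, D l₁ a ≤ 0) :
    ∃ Λ : ℝ → ℝ, Continuous Λ ∧ ∀ a, Λ a ∈ Icc l₀ l₁ ∧ D (Λ a) a = 0 := by
  have hex : ∀ a, ∃ l ∈ Icc l₀ l₁, D l a = 0 := fun a => by
    have hc : Continuous fun l => D l a := hD.comp (continuous_id.prodMk continuous_const)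
    exact intermediate_value_Icc' hl hc.continuousOn ⟨h₁ a, h₀ a⟩
  choose Λ hΛ hΛ0 using hex
  refine ⟨Λ, ?_, fun a => ⟨hΛ a, hΛ0 a⟩⟩
  have hc : ∀ l, Continuous fun a => D l a := fun l =>
    hD.comp (continuous_const.prodMk continuous_id)
  refine continuous_iff_continuousAt.2 fun a => ?_
  refine tendsto_order.2 ⟨fun l hl => ?_, fun l hl => ?_⟩
  · have : 0 < D l a := hΛ0 a ▸ hanti a hl
    filter_upwards [(hc l).continuousAt.eventually_const_lt this] with b hb
    exact (hanti b).lt_iff_gt.1 (hΛ0 b ▸ hb)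
  · have : D l a < 0 := hΛ0 a ▸ hanti a hl
    filter_upwards [(hc l).continuousAt.eventually_lt_const this] with b hb
    exact (hanti b).lt_iff_gt.1 (hΛ0 b ▸ hb)

theorem exists_shooting {G m Q : ℝ → ℝ} {L : NNReal} {B : ℝ} (hG : LipschitzWith L G)
    (hG0 : ∀ w, 0 ≤ G w) (hGB : ∀ w, G w ≤ B) (hm : Continuous m) (hm0 : ∀ w, 0 ≤ w → 0 ≤ m w)
    (hm1 : ∀ w, w ≤ 0 → m w ≤ 0) (hQ : Continuous Q) :
    ∃ (l a : ℝ) (x : ℝ → ℝ), IsShiftedSolution G (fun t => a + Q t - l * t) x ∧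
      x 1 + (a + Q 1 - l * 1) = a ∧ ∫ t in (0 : ℝ)..1, m (x t + (a + Q t - l * t)) = 0 := by
  have hB0 : 0 ≤ B := (hG0 0).trans (hGB 0)
  set H : ℝ → ℝ → ℝ → ℝ := fun l a t => a + Q t - l * t
  have hH : ∀ l a, Continuous (H l a) := fun l a => by fun_prop
  have hex : ∀ l a, ∃ x, IsShiftedSolution G (H l a) x := fun l a =>
    exists_isShiftedSolution (B := ⟨B, hB0⟩) hG
      (fun w => by rw [abs_of_nonneg (hG0 w)]; exact hGB w) (hH l a)
  choose x hx using hex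
  have hxI := fun l a t ht => (hx l a).mem_Icc (t := t) hG.continuous (hH l a) hG0 hGB ht
  have hF : Continuous fun c : (ℝ × ℝ) × ℝ => x c.1.1 c.1.2 (projIcc 0 1 zero_le_one c.2) := by
    refine continuous_prod_of_continuous_lipschitzWith _ (2 * (Real.exp (L + 1)).toNNReal)
      (fun c => (hx c.1 c.2).continuous.comp (continuous_subtype_val.comp continuous_projIcc))
      (fun t => LipschitzWith.of_dist_le_mul fun c c' => ?_)
    have ha : |c.2 - c'.2| ≤ dist c c' := le_max_right _ _
    have hl : |c.1 - c'.1| ≤ dist c c' := le_max_left _ _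
    refine ((hx c.1 c.2).abs_sub_le_mul_exp hG (hx c'.1 c'.2) (d := 2 * dist c c')
      (fun s hs => ?_) (projIcc 0 1 zero_le_one t).2).trans_eq ?_
    · have e : H c.1 c.2 s - H c'.1 c'.2 s = (c.2 - c'.2) - (c.1 - c'.1) * s := by
        simp only [H]; ring
      rw [e]
      refine (abs_sub _ _).trans ?_
      rw [abs_mul, abs_of_nonneg hs.1]
      nlinarith [abs_nonneg (c.1 - c'.1), hs.2]
    · rw [NNReal.coe_mul, Real.coe_toNNReal _ (Real.exp_pos _).le, NNReal.coe_ofNat]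
      ring
  have hp1 : (projIcc (0 : ℝ) 1 zero_le_one 1 : ℝ) = 1 := by simp
  obtain ⟨Λ, hΛ, hΛ0⟩ := exists_continuous_zero_of_strictAnti
    (D := fun l a => x l a 1 + H l a 1 - a) (l₀ := Q 1 - B) (l₁ := Q 1)
    (by
      have h1 : Continuous fun c : ℝ × ℝ => x c.1 c.2 1 := by
        have := hF.comp (continuous_id.prodMk (continuous_const (y := (1 : ℝ))))
        simpa only [Function.comp_def, hp1, id] using this
      have h2 : Continuous fun c : ℝ × ℝ => H c.1 c.2 1 - c.2 := by fun_prop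
      simpa only [Function.uncurry_def, add_sub_assoc, Pi.add_def] using h1.add h2)
    (fun a l l' hl => sub_lt_sub_right ((hx l a).endpoint_lt hG (hx l' a) (sub_pos.2 hl)
      fun t => by simp only [H]; ring) a)
    (by linarith)
    (fun a => by
      have := (hxI (Q 1 - B) a 1 (right_mem_Icc.2 zero_le_one)).1
      simp only [H]; linarith)
    (fun a => by
      have := (hxI (Q 1) a 1 (right_mem_Icc.2 zero_le_one)).2
      simp only [H]; linarith)
  obtain ⟨S, hS⟩ := isCompact_Icc.exists_bound_of_continuousOn (hQ.continuousOn (s := Icc 0 1))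
  simp only [Real.norm_eq_abs] at hS
  have hS1 := abs_le.1 (hS 1 (right_mem_Icc.2 zero_le_one))
  have hbd : ∀ a, ∀ t ∈ Icc (0 : ℝ) 1, |x (Λ a) a t + H (Λ a) a t - a| ≤ 2 * S + 2 * B := by
    intro a t ht
    have h1 := hxI (Λ a) a t ht
    have h2 := abs_le.1 (hS t ht)
    have h3 := (hΛ0 a).1
    have h4 : |Λ a * t| ≤ S + B := by
      rw [abs_mul, abs_of_nonneg ht.1]
      refine (mul_le_of_le_one_right (abs_nonneg _) ht.2).trans (abs_le.2 ⟨?_, ?_⟩)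
      · linarith [h3.1]
      · linarith [h3.2]
    rw [abs_le] at h4 ⊢
    simp only [H]
    constructor
    · linarith [h1.1]
    · linarith [h1.2]
  have hM : Continuous fun a => ∫ t in (0 : ℝ)..1,
      m (x (Λ a) a (projIcc 0 1 zero_le_one t) + H (Λ a) a t) := by
    refine intervalIntegral.continuous_parametric_intervalIntegral_of_continuous' ?_ 0 1
    have h1 := hF.comp (((hΛ.comp continuous_fst).prodMk continuous_fst).prodMk
      (continuous_snd (X := ℝ) (Y := ℝ)))
    have h2 : Continuous fun c : ℝ × ℝ => H (Λ c.1) c.1 c.2 := by fun_prop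
    exact hm.comp (h1.add h2)
  have heq : ∀ a, ∫ t in (0 : ℝ)..1, m (x (Λ a) a (projIcc 0 1 zero_le_one t) + H (Λ a) a t) =
      ∫ t in (0 : ℝ)..1, m (x (Λ a) a t + H (Λ a) a t) := fun a => by
    refine intervalIntegral.integral_congr fun t ht => ?_
    rw [uIcc_of_le zero_le_one] at ht
    simp only [projIcc_of_mem _ ht]
  simp only [heq] at hM
  have hint : ∀ a, IntervalIntegrable (fun t => m (x (Λ a) a t + H (Λ a) a t)) volume 0 1 :=
    fun a => (hm.comp ((hx (Λ a) a).continuous.add (hH _ _))).intervalIntegrable _ _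
  obtain ⟨a, ha⟩ := mem_range_of_exists_le_of_exists_ge hM (c := 0)
    ⟨-(2 * S + 2 * B), by
      have := intervalIntegral.integral_mono_on zero_le_one (hint (-(2 * S + 2 * B)))
        (intervalIntegrable_const (c := (0 : ℝ))) fun t ht => hm1 _ (by
          linarith [(abs_le.1 (hbd (-(2 * S + 2 * B)) t ht)).2])
      simpa using this⟩
    ⟨2 * S + 2 * B, intervalIntegral.integral_nonneg zero_le_one fun t ht => hm0 _ (by
      linarith [(abs_le.1 (hbd (2 * S + 2 * B) t ht)).1])⟩
  exact ⟨Λ a, a, x (Λ a) a, hx _ _, sub_eq_zero.1 (hΛ0 a).2, ha⟩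

theorem eq_comp_fract_of_periodic {W : ℝ → ℝ} (hW : ∀ t, W (t + 1) = W t) (t : ℝ) :
    W (Int.fract t) = W t := by
  have := Function.Periodic.sub_int_mul_eq (f := W) (c := 1) hW (x := t) ⌊t⌋
  rwa [mul_one] at this

/-- The periodic problem for a Riccati-type equation with bounded nonlinearity is solvable, with
the additional normalization `∫ m(W) = 0`. -/
theorem exists_periodic_riccati {G m q : ℝ → ℝ} {L : NNReal} {B : ℝ} (hG : LipschitzWith L G)
    (hG0 : ∀ w, 0 ≤ G w) (hGB : ∀ w, G w ≤ B) (hm : Continuous m) (hm0 : ∀ w, 0 ≤ w → 0 ≤ m w)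
    (hm1 : ∀ w, w ≤ 0 → m w ≤ 0) (hqper : ∀ t, q (t + 1) = q t)
    (hq : ∀ a b, IntervalIntegrable q volume a b) :
    ∃ (l : ℝ) (W : ℝ → ℝ), Continuous W ∧ (∀ t, W (t + 1) = W t) ∧
      (∀ a b, W b - W a = ∫ t in a..b, (q t - l - G (W t))) ∧
      ∫ t in (0 : ℝ)..1, m (W t) = 0 := by
  have hQ : Continuous fun t => ∫ s in (0 : ℝ)..t, q s := intervalIntegral.continuous_primitive hq 0
  obtain ⟨l, a, x, hx, h1, hM⟩ := exists_shooting hG hG0 hGB hm hm0 hm1 hQ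
  have hH : Continuous fun t => a + (∫ s in (0 : ℝ)..t, q s) - l * t := by fun_prop
  set w : ℝ → ℝ := fun t => x t + (a + (∫ s in (0 : ℝ)..t, q s) - l * t)
  have hw : Continuous w := hx.continuous.add hH
  have hw0 : w 0 = a := by simp [w, hx.map_zero]
  have hw1 : w 1 = a := h1
  set W : ℝ → ℝ := w ∘ Int.fract
  have hWc : Continuous W := hw.continuousOn.comp_fract'' (hw0.trans hw1.symm)
  have hWper : ∀ t, W (t + 1) = W t := fun t => by simp [W]
  have hWw : ∀ t ∈ Icc (0 : ℝ) 1, W t = w t := fun t ht => by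
    rcases ht.2.lt_or_eq with h | rfl
    · simp [W, Int.fract_eq_self.2 ⟨ht.1, h⟩]
    · simp [W, hw0, hw1]
  have hint : ∀ a b, IntervalIntegrable (fun t => q t - l - G (W t)) volume a b := fun a b =>
    ((hq a b).sub intervalIntegrable_const).sub
      ((hG.continuous.comp hWc).intervalIntegrable _ _)
  have hloc : ∀ t ∈ Icc (0 : ℝ) 1, W t - ∫ s in (0 : ℝ)..t, (q s - l - G (W s)) = a := by
    intro t ht
    have hGW : IntervalIntegrable (fun s => G (W s)) volume 0 t :=
      (hG.continuous.comp hWc).intervalIntegrable _ _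
    have hql : IntervalIntegrable (fun s => q s - l) volume 0 t :=
      (hq 0 t).sub intervalIntegrable_const
    rw [intervalIntegral.integral_sub hql hGW,
      intervalIntegral.integral_sub (hq 0 t) intervalIntegrable_const,
      intervalIntegral.integral_const, hWw t ht]
    have : ∫ s in (0 : ℝ)..t, G (W s) = ∫ s in (0 : ℝ)..t, G (w s) :=
      intervalIntegral.integral_congr fun s hs => by
        rw [uIcc_of_le ht.1] at hs
        simp only [hWw s ⟨hs.1, hs.2.trans ht.2⟩]
    rw [this]
    have hxt := hx.eq_neg_integral hG.continuous hH ht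
    simp only [w, smul_eq_mul] at hxt ⊢
    rw [hxt]
    ring
  have hper : ∀ t, (W (t + 1) - ∫ s in (0 : ℝ)..(t + 1), (q s - l - G (W s))) =
      W t - ∫ s in (0 : ℝ)..t, (q s - l - G (W s)) := fun t => by
    have h01 : ∫ s in (0 : ℝ)..1, (q s - l - G (W s)) = 0 := by
      have := hloc 1 (right_mem_Icc.2 zero_le_one)
      rw [hWw 1 (right_mem_Icc.2 zero_le_one), hw1] at this
      linarith
    have hp : Function.Periodic (fun s => q s - l - G (W s)) 1 := fun s => by
      simp only [hqper, hWper]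
    have := hp.intervalIntegral_add_eq t 0
    rw [zero_add, h01] at this
    rw [hWper, ← intervalIntegral.integral_add_adjacent_intervals (hint 0 t) (hint t (t + 1)), this,
      add_zero]
  have hall : ∀ t, W t - ∫ s in (0 : ℝ)..t, (q s - l - G (W s)) = a := fun t =>
    (eq_comp_fract_of_periodic (W := fun t => W t - ∫ s in (0 : ℝ)..t, (q s - l - G (W s)))
      hper t).symm.trans (hloc _ ⟨Int.fract_nonneg t, (Int.fract_lt_one t).le⟩)
  refine ⟨l, W, hWc, hWper, fun b c => ?_, ?_⟩
  · rw [← intervalIntegral.integral_interval_sub_left (hint 0 c) (hint 0 b)]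
    linarith [hall b, hall c]
  · refine Eq.trans (intervalIntegral.integral_congr fun t ht => ?_) hM
    rw [uIcc_of_le zero_le_one] at ht
    simp only [hWw t ht, w]

theorem neg_le_of_periodic_riccati {G q W : ℝ → ℝ} {l t₀ C M : ℝ} (hG : Continuous G)
    (hW : Continuous W) (hW0 : W t₀ = 0) (hW1 : W (t₀ + 1) = 0)
    (hq : ∀ a b, IntervalIntegrable q volume a b)
    (hint : ∀ a b, W b - W a = ∫ t in a..b, (q t - l - G (W t)))
    (hC : ∀ t ∈ Icc t₀ (t₀ + 1), |∫ s in t₀..t, q s| ≤ C)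
    (hM : ∀ w, |w| ≤ 3 * (C + 1) → G w ≤ M) : -l ≤ M + 2 * (C + 1) := by
  by_contra! hl
  have hC0 : 0 ≤ C := (abs_nonneg _).trans (hC t₀ (left_mem_Icc.2 (by linarith)))
  have hc : Continuous fun t => -l - G (W t) := by fun_prop
  have hd : ∀ t, HasDerivAt (fun t => ∫ s in t₀..t, (-l - G (W s))) (-l - G (W t)) t := fun t =>
    (hc.integral_hasStrictDerivAt t₀ t).hasDerivAt
  have hWt : ∀ t, W t = (∫ s in t₀..t, q s) + ∫ s in t₀..t, (-l - G (W s)) := fun t => by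
    rw [← intervalIntegral.integral_add (hq _ _) (hc.intervalIntegrable _ _), ← sub_zero (W t),
      ← hW0, hint t₀ t]
    exact intervalIntegral.integral_congr fun s _ => by ring
  have hfence := image_le_of_deriv_right_lt_deriv_boundary' (a := t₀) (b := t₀ + 1)
    (f := fun t => 2 * (C + 1) * (t - t₀)) (f' := fun _ => 2 * (C + 1))
    (B := fun t => ∫ s in t₀..t, (-l - G (W s))) (B' := fun t => -l - G (W t))
    (by fun_prop)
    (fun t _ => by
      simpa using (((hasDerivAt_id t).sub_const t₀).const_mul (2 * (C + 1))).hasDerivWithinAt)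
    (by simp) (fun t _ => (hd t).continuousAt.continuousWithinAt)
    (fun t _ => (hd t).hasDerivWithinAt)
    (fun t ht heq => by
      have h1 := abs_le.1 (hC t (Ico_subset_Icc_self ht))
      have h2 : |W t| ≤ 3 * (C + 1) := by
        rw [hWt t, ← heq, abs_le]
        constructor <;> nlinarith [ht.1, ht.2]
      linarith [hM _ h2])
    (right_mem_Icc.2 (by linarith))
  have h1 := abs_le.1 (hC (t₀ + 1) (right_mem_Icc.2 (by linarith)))
  have h2 := hWt (t₀ + 1)
  simp only [add_sub_cancel_left, mul_one] at hfence
  linarith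

theorem abs_le_of_periodic_riccati {G q W : ℝ → ℝ} {l t₀ C E : ℝ} (hG : Continuous G)
    (hG0 : ∀ w, 0 ≤ G w) (hW : Continuous W) (hW0 : W t₀ = 0) (hW1 : W (t₀ + 1) = 0)
    (hq : ∀ a b, IntervalIntegrable q volume a b)
    (hint : ∀ a b, W b - W a = ∫ t in a..b, (q t - l - G (W t)))
    (hC : ∀ t ∈ Icc t₀ (t₀ + 1), |∫ s in t₀..t, q s| ≤ C) (hE : 0 ≤ E) (hl : -l ≤ E)
    {t : ℝ} (ht : t ∈ Icc t₀ (t₀ + 1)) : |W t| ≤ 2 * C + E := by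
  have hGW : Continuous fun t => G (W t) := by fun_prop
  have hdec : ∀ a b, W b - W a = (∫ s in a..b, q s) - (b - a) * l - ∫ s in a..b, G (W s) := by
    intro a b
    have hql : IntervalIntegrable (fun s => q s - l) volume a b :=
      (hq a b).sub intervalIntegrable_const
    rw [hint, intervalIntegral.integral_sub hql (hGW.intervalIntegrable _ _),
      intervalIntegral.integral_sub (hq a b) intervalIntegrable_const,
      intervalIntegral.integral_const, smul_eq_mul]
  have h1 := hdec t₀ t
  have h2 := hdec t (t₀ + 1)
  have h3 := abs_le.1 (hC t ht)
  have h4 := abs_le.1 (hC (t₀ + 1) (right_mem_Icc.2 (by linarith)))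
  have h5 := intervalIntegral.integral_add_adjacent_intervals (hq t₀ t) (hq t (t₀ + 1))
  have h6 : 0 ≤ ∫ s in t₀..t, G (W s) := intervalIntegral.integral_nonneg ht.1 fun s _ => hG0 _
  have h7 : 0 ≤ ∫ s in t..(t₀ + 1), G (W s) :=
    intervalIntegral.integral_nonneg ht.2 fun s _ => hG0 _
  have h8 : (t - t₀) * -l ≤ E := by nlinarith [ht.1, ht.2]
  have h9 : (t₀ + 1 - t) * -l ≤ E := by nlinarith [ht.1, ht.2]
  rw [abs_le]
  constructor <;> nlinarith

theorem abs_integral_le_of_periodic {q : ℝ → ℝ} (hqper : ∀ t, q (t + 1) = q t)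
    (hq : ∀ a b, IntervalIntegrable q volume a b) (t₀ : ℝ) {t : ℝ} (ht : t ∈ Icc t₀ (t₀ + 1)) :
    |∫ s in t₀..t, q s| ≤ ∫ s in (0 : ℝ)..1, |q s| := by
  have hp : Function.Periodic (fun s => |q s|) 1 := fun s => by simp only [hqper]
  have h := hp.intervalIntegral_add_eq t₀ 0
  rw [zero_add] at h
  rw [← h]
  exact (intervalIntegral.abs_integral_le_integral_abs ht.1).trans
    (intervalIntegral.integral_mono_interval le_rfl ht.1 ht.2
      (ae_of_all _ fun s => abs_nonneg (q s)) (hq _ _).abs)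

theorem exists_lipschitzWith_truncated_rpow {r : ℝ} (hr : 0 < r) {K : ℝ} (hK : 0 ≤ K) :
    ∃ L, LipschitzWith L fun w : ℝ => r * |min |w| K| ^ (1 + r⁻¹) := by
  have h1 : ContDiff ℝ 1 fun w : ℝ => r * |w| ^ (1 + r⁻¹) :=
    contDiff_const.mul (contDiff_abs_rpow_one_add (inv_pos.2 hr))
  obtain ⟨L, hL⟩ := (h1.locallyLipschitz.locallyLipschitzOn
    (s := Icc 0 K)).exists_lipschitzOnWith_of_compact isCompact_Icc
  have h2 : LipschitzWith 1 fun w : ℝ => min |w| K := lipschitzWith_one_norm.min_const K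
  refine ⟨L * 1, lipschitzOnWith_univ.1 (hL.comp h2.lipschitzOnWith fun w _ => ?_)⟩
  exact ⟨le_min (abs_nonneg w) hK, min_le_right _ _⟩

theorem exists_periodic_riccati_rpow {r : ℝ} (hr : 0 < r) {q : ℝ → ℝ}
    (hqper : ∀ t, q (t + 1) = q t) (hq : ∀ a b, IntervalIntegrable q volume a b) :
    ∃ (l : ℝ) (W : ℝ → ℝ), Continuous W ∧ (∀ t, W (t + 1) = W t) ∧
      (∀ a b, W b - W a = ∫ t in a..b, (q t - l - r * |W t| ^ (1 + r⁻¹))) ∧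
      ∫ t in (0 : ℝ)..1, sgnPow r⁻¹ (W t) = 0 := by
  have hri : 0 < r⁻¹ := inv_pos.2 hr
  set C := ∫ s in (0 : ℝ)..1, |q s|
  have hC0 : 0 ≤ C := intervalIntegral.integral_nonneg zero_le_one fun s _ => abs_nonneg _
  set M := r * (3 * (C + 1)) ^ (1 + r⁻¹)
  have hM0 : 0 ≤ M := by positivity
  set E := M + 2 * (C + 1)
  have hE0 : 0 ≤ E := by positivity
  obtain ⟨L, hL⟩ := exists_lipschitzWith_truncated_rpow hr (K := 2 * C + E) (by positivity)
  set G : ℝ → ℝ := fun w => r * |min |w| (2 * C + E)| ^ (1 + r⁻¹)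
  have habs : ∀ w : ℝ, |min |w| (2 * C + E)| = min |w| (2 * C + E) := fun w =>
    abs_of_nonneg (le_min (abs_nonneg w) (by positivity))
  have hG0 : ∀ w, 0 ≤ G w := fun w => by positivity
  have hGB : ∀ w, G w ≤ r * (2 * C + E) ^ (1 + r⁻¹) := fun w => by
    simp only [G, habs]
    gcongr
    exact min_le_right _ _
  have hGM : ∀ w, |w| ≤ 3 * (C + 1) → G w ≤ M := fun w hw => by
    simp only [G, habs, M]
    gcongr
    exact (min_le_left _ _).trans hw
  have hsg : ∀ w, 0 ≤ w → 0 ≤ sgnPow r⁻¹ w := fun w hw => by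
    rcases hw.eq_or_lt with rfl | hw
    · simp [sgnPow]
    · rw [sgnPow_of_pos _ hw]
      positivity
  obtain ⟨l, W, hWc, hWper, hint, hm⟩ := exists_periodic_riccati hL hG0 hGB
    (continuous_sgnPow hri)
    (fun w hw => hsg w hw)
    (fun w hw => by simpa [sgnPow_neg] using hsg (-w) (neg_nonneg.2 hw)) hqper hq
  obtain ⟨t₀, ht₀⟩ : ∃ t₀, W t₀ = 0 := by
    have hc : Continuous fun t => sgnPow r⁻¹ (W t) := (continuous_sgnPow hri).comp hWc
    obtain ⟨t, -, ht⟩ := exists_hasDerivAt_eq_zero (f := fun t => ∫ s in (0 : ℝ)..t,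
      sgnPow r⁻¹ (W s)) zero_lt_one
      (intervalIntegral.continuous_primitive (fun a b => hc.intervalIntegrable a b) 0).continuousOn
      (by rw [hm, intervalIntegral.integral_same])
      (fun t _ => hc.integral_hasStrictDerivAt 0 t |>.hasDerivAt)
    exact ⟨t, by rw [← sgnPow_sgnPow_inv hr (W t), ht, sgnPow_zero]⟩
  have hW1 : W (t₀ + 1) = 0 := (hWper t₀).trans ht₀
  have hC := fun t ht => abs_integral_le_of_periodic hqper hq t₀ (t := t) ht
  have hl := neg_le_of_periodic_riccati hL.continuous hWc ht₀ hW1 hq hint hC hGM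
  have hWle : ∀ t, |W t| ≤ 2 * C + E := fun t => by
    obtain ⟨s, hs, hst⟩ := Function.Periodic.exists_mem_Ico (f := W) hWper one_pos t t₀
    rw [hst]
    exact abs_le_of_periodic_riccati hL.continuous hG0 hWc ht₀ hW1 hq hint hC hE0 hl
      (Ico_subset_Icc_self hs)
  refine ⟨l, W, hWc, hWper, fun a b => ?_, hm⟩
  rw [hint]
  refine intervalIntegral.integral_congr fun t _ => ?_
  simp only [G, min_eq_left (hWle t), abs_abs]

theorem isPeriodicEig_of_riccati {r : ℝ} (hr : 0 < r) {q W : ℝ → ℝ} {l : ℝ} (hW : Continuous W)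
    (hW1 : W 1 = W 0) (hq : ∀ a b, IntervalIntegrable q volume a b)
    (hint : ∀ a b, W b - W a = ∫ t in a..b, (r * q t - l - r * |W t| ^ (1 + r⁻¹)))
    (hm : ∫ t in (0 : ℝ)..1, sgnPow r⁻¹ (W t) = 0) : IsPeriodicEig (1 + r) q (l / r) := by
  have hri : 0 < r⁻¹ := inv_pos.2 hr
  have hc : Continuous fun t => sgnPow r⁻¹ (W t) := (continuous_sgnPow hri).comp hW
  set V : ℝ → ℝ := fun t => ∫ s in (0 : ℝ)..t, sgnPow r⁻¹ (W s)
  have hV : ∀ t, HasDerivAt V (sgnPow r⁻¹ (W t)) t := fun t =>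
    (hc.integral_hasStrictDerivAt 0 t).hasDerivAt
  have hVc : Continuous V := continuous_iff_continuousAt.2 fun t => (hV t).continuousAt
  have hV0 : V 0 = 0 := intervalIntegral.integral_same
  have hY : ∀ t, HasDerivAt (fun t => Real.exp (V t)) (Real.exp (V t) * sgnPow r⁻¹ (W t)) t :=
    fun t => (hV t).exp
  have hYd : deriv (fun t => Real.exp (V t)) = fun t => Real.exp (V t) * sgnPow r⁻¹ (W t) :=
    funext fun t => (hY t).deriv
  have hYr : ∀ t, sgnPow r (Real.exp (V t)) = Real.exp (r * V t) := fun t => by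
    rw [sgnPow_of_pos _ (Real.exp_pos _), ← Real.exp_mul, mul_comm]
  have hYW : ∀ t, sgnPow r (Real.exp (V t) * sgnPow r⁻¹ (W t)) = Real.exp (r * V t) * W t :=
    fun t => by rw [sgnPow_mul, hYr, sgnPow_sgnPow_inv hr]
  refine ⟨fun t => Real.exp (V t), fun t => (hY t).differentiableAt, ⟨0, (Real.exp_pos _).ne'⟩,
    fun a b => ?_, ?_, ?_⟩
  · rw [add_sub_cancel_left, hYd]
    simp only [hYW, hYr]
    have hg : ∀ a b, IntervalIntegrable (fun t => r * q t - l - r * |W t| ^ (1 + r⁻¹))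
        volume a b := fun a b => by
      have h1 : Continuous fun t => r * |W t| ^ (1 + r⁻¹) :=
        continuous_const.mul ((contDiff_abs_rpow_one_add hri).continuous.comp hW)
      exact (((hq a b).const_mul r).sub intervalIntegrable_const).sub (h1.intervalIntegrable a b)
    have hW' := HasACDerivOn.of_integral (C := W 0) hg
      (fun t => sub_eq_iff_eq_add'.1 (hint 0 t)) a b
    have hE := HasACDerivOn.of_hasDerivAt (f := fun t => Real.exp (r * V t))
      (fun t => ((hV t).const_mul r).exp) (by fun_prop) a b
    rw [← (hE.mul hW').integral_eq_sub, ← intervalIntegral.integral_neg]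
    refine intervalIntegral.integral_congr fun t _ => ?_
    simp only [← self_mul_sgnPow hri]
    field_simp
    ring
  · simp only [hV0, show V 1 = 0 from hm]
  · simp only [hYd, hV0, show V 1 = 0 from hm, hW1]

theorem ae_eq_zero_of_le_of_integral_eq_zero {r : ℝ} (hr : 0 < r) {q : ℝ → ℝ}
    (hqper : ∀ t, q (t + 1) = q t) (hq : ∀ a b, IntervalIntegrable q volume a b)
    (hq0 : ∫ t in (0 : ℝ)..1, q t = 0) (hleast : ∀ lam, IsPeriodicEig (1 + r) q lam → 0 ≤ lam) :
    ∀ᵐ x, x ∈ Icc (0 : ℝ) 1 → q x = 0 := by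
  obtain ⟨l, W, hW, hWper, hint, hm⟩ := exists_periodic_riccati_rpow hr (q := fun t => r * q t)
    (fun t => by rw [hqper]) (fun a b => (hq a b).const_mul r)
  have hW1 : W 1 = W 0 := by simpa using hWper 0
  have hl : 0 ≤ l := by
    have := hleast _ (isPeriodicEig_of_riccati hr hW hW1 hq hint hm)
    simpa [hr.le, hr, div_nonneg_iff, not_le.2 hr] using this
  have hc : Continuous fun t => r * |W t| ^ (1 + r⁻¹) :=
    continuous_const.mul ((contDiff_abs_rpow_one_add (inv_pos.2 hr)).continuous.comp hW)
  have hql : ∀ a b, IntervalIntegrable (fun t => r * q t - l) volume a b := fun a b =>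
    ((hq a b).const_mul r).sub intervalIntegrable_const
  have h0 : -l - ∫ t in (0 : ℝ)..1, r * |W t| ^ (1 + r⁻¹) = 0 := by
    have := hint 0 1
    rw [hW1, sub_self, intervalIntegral.integral_sub (hql 0 1) (hc.intervalIntegrable _ _),
      intervalIntegral.integral_sub ((hq 0 1).const_mul r) intervalIntegrable_const,
      intervalIntegral.integral_const_mul r q, hq0, intervalIntegral.integral_const] at this
    simpa using this.symm
  have hnn : 0 ≤ ∫ t in (0 : ℝ)..1, r * |W t| ^ (1 + r⁻¹) :=
    intervalIntegral.integral_nonneg zero_le_one fun t _ => by positivity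
  have hl0 : l = 0 := by linarith
  have hW0 : ∀ t, W t = 0 := fun t => by
    obtain ⟨s, hs, hst⟩ := Function.Periodic.exists_mem_Ico₀ (f := W) hWper one_pos t
    rw [hst]
    by_contra hne
    have := intervalIntegral.integral_pos zero_lt_one hc.continuousOn (fun t _ => by positivity)
      ⟨s, Ico_subset_Icc_self hs, by positivity⟩
    linarith
  have hg : ∀ a b, IntervalIntegrable (fun t => r * q t - l - r * |W t| ^ (1 + r⁻¹))
      volume a b := fun a b => (hql a b).sub (hc.intervalIntegrable a b)
  filter_upwards [(HasACDerivOn.of_integral (C := W 0) hg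
    (fun t => sub_eq_iff_eq_add'.1 (hint 0 t)) 0 1).deriv] with t ht hmem
  have h := ht (uIcc_of_le (zero_le_one' ℝ) ▸ hmem)
  rw [funext hW0] at h
  have h2 := h.unique (hasDerivAt_const t 0)
  rw [hl0, abs_zero, zero_rpow (by positivity)] at h2
  simpa [hr.ne'] using h2

/-- Ambarzumyan theorem for the periodic `p`-Laplacian. -/
theorem ambarzumyan_periodic (p : ℝ) (hp : 1 < p)
    (q : ℝ → ℝ) (hqper : ∀ x, q (x + 1) = q x) (hq : IntegrableOn q (Set.Icc 0 1))
    (hspec : ∀ n : ℕ, IsPeriodicEig p q ((2 * n * pihat p) ^ p))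
    (hleast : ∀ lam : ℝ, IsPeriodicEig p q lam → 0 ≤ lam) :
    ∀ᵐ x ∂(volume.restrict (Set.Icc (0:ℝ) 1)), q x = 0 := by
  obtain ⟨r, rfl⟩ : ∃ r, p = 1 + r := ⟨p - 1, by ring⟩
  have hr : 0 < r := by linarith
  have hqi := intervalIntegrable_of_periodic hqper hq
  exact (ae_restrict_iff' measurableSet_Icc).2 (ae_eq_zero_of_le_of_integral_eq_zero hr hqper hqi
    (integral_eq_zero_of_spectrum hr hqi hspec) hleast)
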